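/- arXiv:1307.8386 — 5 statements merged into one kernel-verified Lean document; each statement's English description precedes it below -/
import Mathlib

section
/- Suppose Δ = 4ab − c² is a nonsquare in F (so Q is an elliptic quadric). Then the number of points of PG(3,q²) lying on both H and Q is one of the seven values q³−q²+1, q³−q²+q+1, q³−q+1, q³+1, q³+q+1, q³+q²−q+1, q³+q²+1. -/
/-- The Hermitian surface `H` of `PG(3,q²)`: points `[j:x:y:z]` with
`j^q·z + j·z^q = x^(q+1) + y^(q+1)`, as a condition on a representative vector. -/
def hermPt (q : ℕ) {F : Type} [Field F] (v : Fin 4 → F) : Prop :=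
  (v 0) ^ q * v 3 + v 0 * (v 3) ^ q = (v 1) ^ (q + 1) + (v 2) ^ (q + 1)

/-- The quadric `Q`: points `[j:x:y:z]` with
`j·z = a·x² + b·y² + c·x·y + d·x·j + e·y·j + f·j²`. -/
def quadPt {F : Type} [Field F] (a b c d e f : F) (v : Fin 4 → F) : Prop :=
  v 0 * v 3 =
    a * (v 1) ^ 2 + b * (v 2) ^ 2 + c * (v 1) * (v 2) +
      d * (v 1) * (v 0) + e * (v 2) * (v 0) + f * (v 0) ^ 2

/-- The number of solutions of `f a = s`, as an integer. -/
noncomputable def solCount {A K : Type*} (f : A → K) (s : K) : ℤ := Nat.card {a // f a = s}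

section Counting

variable {K : Type*} [Field K] [Fintype K] {A B : Type*}

omit [Fintype K] in
lemma solCount_congr_add {f : A → K} {g : B → K} (e : A ≃ B) {k : K}
    (h : ∀ a, g (e a) = f a + k) (s : K) : solCount f s = solCount g (s + k) := by
  unfold solCount
  rw [Nat.card_congr (e.subtypeEquiv (q := fun b => g b = s + k) fun a => by simp [h])]

omit [Field K] in
lemma sum_solCount [Finite A] (f : A → K) : ∑ s, solCount f s = Nat.card A := by
  unfold solCount
  rw [← Nat.cast_sum, ← Nat.card_sigma, Nat.card_congr (Equiv.sigmaFiberEquiv f)]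

lemma solCount_add [Finite A] [Finite B] (f : A → K) (g : B → K) (t : K) :
    solCount (fun p : A × B => f p.1 + g p.2) t = ∑ s, solCount f s * solCount g (t - s) := by
  unfold solCount
  simp only [← Nat.cast_mul, ← Nat.card_prod]
  rw [← Nat.cast_sum, ← Nat.card_sigma]
  congr 1
  exact Nat.card_congr
    { toFun := fun p => ⟨f p.1.1, ⟨p.1.1, rfl⟩, ⟨p.1.2, eq_sub_of_add_eq' p.2⟩⟩
      invFun := fun x => ⟨(x.2.1.1, x.2.2.1), by simp [x.2.1.2, x.2.2.2]⟩
      left_inv := fun p => rfl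
      right_inv := by
        rintro ⟨s, ⟨a, rfl⟩, ⟨b, hb⟩⟩
        rfl }

omit [Fintype K] in
lemma solCount_linear {l : K} (hl : l ≠ 0) (s : K) : solCount (fun x => l * x) s = 1 := by
  have : Unique {x // l * x = s} :=
    { default := ⟨l⁻¹ * s, by field_simp⟩
      uniq := fun x => Subtype.ext (by simp [← x.2, hl]) }
  simp [solCount]

variable [DecidableEq K]

lemma quadraticChar_div (a b : K) :
    quadraticChar K (a / b) = quadraticChar K b * quadraticChar K a := by
  by_cases hb : b = 0
  · simp [hb]
  · rw [← map_mul, ← mul_one (quadraticChar K (a / b)), ← quadraticChar_sq_one' hb, ← map_mul]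
    congr 1
    field_simp

lemma solCount_sq (hK : ringChar K ≠ 2) {w : K} (hw : w ≠ 0) (s : K) :
    solCount (fun x => w * x ^ 2) s = 1 + quadraticChar K w * quadraticChar K s := by
  rw [← quadraticChar_div, add_comm, ← quadraticChar_card_sqrts hK, solCount, Set.toFinset_card,
    ← Nat.card_eq_fintype_card]
  congr 1
  refine Nat.card_congr (Equiv.subtypeEquivRight fun x => ?_)
  simp only [Set.mem_ofPred_eq]
  rw [eq_div_iff hw, mul_comm]

lemma sum_quadraticChar_mul_sub (hK : ringChar K ≠ 2) (t : K) :
    ∑ s, quadraticChar K s * quadraticChar K (t - s) =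
      quadraticChar K (-1) * ((if t = 0 then (Fintype.card K : ℤ) else 0) - 1) := by
  split_ifs with ht
  · subst ht
    have h : ∀ s : K, quadraticChar K s * quadraticChar K (0 - s) =
        quadraticChar K (-1) * (1 - if s = 0 then 1 else 0) := by
      intro s
      rw [zero_sub, ← neg_one_mul s, map_mul]
      split_ifs with hs
      · simp [hs]
      · linear_combination quadraticChar K (-1) * quadraticChar_sq_one hs
    simp only [h, ← Finset.mul_sum, Finset.sum_sub_distrib]
    simp
  · have h := jacobiSum_nontrivial_inv (quadraticChar_ne_one hK)
    rw [(quadraticChar_isQuadratic K).inv, jacobiSum] at h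
    rw [zero_sub, mul_neg_one, ← h, ← Equiv.sum_comp (Equiv.mulLeft₀ t ht)]
    refine Finset.sum_congr rfl fun s _ => ?_
    have : t - t * s = t * (1 - s) := by ring
    simp only [Equiv.mulLeft₀_apply, this, map_mul]
    linear_combination quadraticChar K s * quadraticChar K (1 - s) * quadraticChar_sq_one ht

lemma sum_quadraticChar_sub (hK : ringChar K ≠ 2) (t : K) :
    ∑ s, quadraticChar K (t - s) = 0 := by
  rw [← quadraticChar_sum_zero hK]
  exact (Equiv.subLeft t).sum_comp _

lemma solCount_sq_add_sq (hK : ringChar K ≠ 2) {w₁ w₂ : K} (h₁ : w₁ ≠ 0) (h₂ : w₂ ≠ 0) (t : K) :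
    solCount (fun p : K × K => w₁ * p.1 ^ 2 + w₂ * p.2 ^ 2) t =
      Fintype.card K + quadraticChar K (-(w₁ * w₂)) *
        ((if t = 0 then (Fintype.card K : ℤ) else 0) - 1) := by
  have h := solCount_add (fun x : K => w₁ * x ^ 2) (fun x : K => w₂ * x ^ 2) t
  have e : ∀ s : K, (1 + quadraticChar K w₁ * quadraticChar K s) *
      (1 + quadraticChar K w₂ * quadraticChar K (t - s)) =
      1 + quadraticChar K w₁ * quadraticChar K s + quadraticChar K w₂ * quadraticChar K (t - s) +
      quadraticChar K w₁ * quadraticChar K w₂ * (quadraticChar K s * quadraticChar K (t - s)) := by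
    intro s; ring
  simp only [solCount_sq hK h₁, solCount_sq hK h₂, e, Finset.sum_add_distrib, ← Finset.mul_sum,
    sum_quadraticChar_mul_sub hK, sum_quadraticChar_sub hK, quadraticChar_sum_zero hK] at h
  rw [h, ← neg_one_mul (w₁ * w₂), map_mul, map_mul]
  simp only [Finset.sum_const, Finset.card_univ, nsmul_eq_mul]
  ring

lemma sum_indicator_mul (f : K → ℤ) :
    ∑ s, (if s = 0 then (Fintype.card K : ℤ) else 0) * f s = Fintype.card K * f 0 := by
  simp

lemma solCount_three_sq (hK : ringChar K ≠ 2) {w₁ w₂ w₃ : K} (h₁ : w₁ ≠ 0) (h₂ : w₂ ≠ 0)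
    (h₃ : w₃ ≠ 0) (t : K) :
    solCount (fun p : (K × K) × K => w₁ * p.1.1 ^ 2 + w₂ * p.1.2 ^ 2 + w₃ * p.2 ^ 2) t =
      Fintype.card K ^ 2 + quadraticChar K (-(w₁ * w₂)) * quadraticChar K w₃ *
        quadraticChar K t * Fintype.card K := by
  have h := solCount_add (fun p : K × K => w₁ * p.1 ^ 2 + w₂ * p.2 ^ 2)
    (fun x : K => w₃ * x ^ 2) t
  have hs := sum_solCount (fun p : K × K => w₁ * p.1 ^ 2 + w₂ * p.2 ^ 2)
  rw [h]
  simp only [solCount_sq hK h₃, mul_add, mul_one, Finset.sum_add_distrib, hs]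
  simp only [solCount_sq_add_sq hK h₁ h₂]
  have e : ∀ s : K, ((Fintype.card K : ℤ) + quadraticChar K (-(w₁ * w₂)) *
        ((if s = 0 then (Fintype.card K : ℤ) else 0) - 1)) *
        (quadraticChar K w₃ * quadraticChar K (t - s)) =
      (Fintype.card K - quadraticChar K (-(w₁ * w₂))) * quadraticChar K w₃ *
        quadraticChar K (t - s) + quadraticChar K (-(w₁ * w₂)) * quadraticChar K w₃ *
        ((if s = 0 then (Fintype.card K : ℤ) else 0) * quadraticChar K (t - s)) := by
    intro s; ring
  simp only [e, Finset.sum_add_distrib, ← Finset.mul_sum, sum_quadraticChar_sub hK,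
    sum_indicator_mul]
  simp
  ring

lemma solCount_four_sq (hK : ringChar K ≠ 2) {w₁ w₂ w₃ w₄ : K} (h₁ : w₁ ≠ 0) (h₂ : w₂ ≠ 0)
    (h₃ : w₃ ≠ 0) (h₄ : w₄ ≠ 0) (t : K) :
    solCount (fun p : (K × K) × (K × K) =>
      (w₁ * p.1.1 ^ 2 + w₂ * p.1.2 ^ 2) + (w₃ * p.2.1 ^ 2 + w₄ * p.2.2 ^ 2)) t =
      Fintype.card K ^ 3 + quadraticChar K (-(w₁ * w₂)) * quadraticChar K (-(w₃ * w₄)) *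
        ((if t = 0 then (Fintype.card K : ℤ) ^ 2 else 0) - Fintype.card K) := by
  rw [solCount_add (fun p : K × K => w₁ * p.1 ^ 2 + w₂ * p.2 ^ 2)
    (fun p : K × K => w₃ * p.1 ^ 2 + w₄ * p.2 ^ 2) t]
  have hs := sum_solCount (fun p : K × K => w₃ * p.1 ^ 2 + w₄ * p.2 ^ 2)
  rw [← (Equiv.subLeft t).sum_comp] at hs
  simp only [Equiv.subLeft_apply] at hs
  have e : ∀ s : K, solCount (fun p : K × K => w₁ * p.1 ^ 2 + w₂ * p.2 ^ 2) s *
        solCount (fun p : K × K => w₃ * p.1 ^ 2 + w₄ * p.2 ^ 2) (t - s) =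
      (Fintype.card K - quadraticChar K (-(w₁ * w₂))) *
        solCount (fun p : K × K => w₃ * p.1 ^ 2 + w₄ * p.2 ^ 2) (t - s) +
        quadraticChar K (-(w₁ * w₂)) * ((if s = 0 then (Fintype.card K : ℤ) else 0) *
          solCount (fun p : K × K => w₃ * p.1 ^ 2 + w₄ * p.2 ^ 2) (t - s)) := by
    intro s; rw [solCount_sq_add_sq hK h₁ h₂]; ring
  simp only [e, Finset.sum_add_distrib, ← Finset.mul_sum, hs, sum_indicator_mul, sub_zero]
  rw [solCount_sq_add_sq hK h₃ h₄]
  split_ifs <;> simp <;> ring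

/-- Coordinates of a vector of `K⁴`, shifted by a constant vector. -/
def shiftedCoords (m : Fin 4 → K) : (Fin 4 → K) ≃ ((K × K) × K) × K where
  toFun x := (((x 0 + m 0, x 1 + m 1), x 2 + m 2), x 3 + m 3)
  invFun p := ![p.1.1.1 - m 0, p.1.1.2 - m 1, p.1.2 - m 2, p.2 - m 3]
  left_inv x := by ext i; fin_cases i <;> simp
  right_inv p := by simp

omit [Fintype K] [DecidableEq K] in
lemma complete_square (h2 : (2 : K) ≠ 0) {w : K} (hw : w ≠ 0) (l x : K) :
    w * (x + l / (2 * w)) ^ 2 = w * x ^ 2 + l * x + l ^ 2 / (4 * w) := by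
  have h4 : (4 : K) ≠ 0 := by
    have : (4 : K) = 2 * 2 := by norm_num
    rw [this]; exact mul_ne_zero h2 h2
  field_simp
  ring

/-- The possible numbers of points of an affine quadric of rank at least three in dimension four
over a field with `q` elements. -/
def affineQuadricSizes (q : ℤ) : Set ℤ :=
  {q ^ 3 - q ^ 2, q ^ 3 - q ^ 2 + q, q ^ 3 - q, q ^ 3, q ^ 3 + q, q ^ 3 + q ^ 2 - q, q ^ 3 + q ^ 2}

lemma solCount_diagonal_of_ne_zero (hK : ringChar K ≠ 2) (w l : Fin 4 → K) (hw : ∀ i, w i ≠ 0)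
    (t : K) : solCount (fun x : Fin 4 → K => ∑ i, (w i * x i ^ 2 + l i * x i)) t ∈
      affineQuadricSizes (Fintype.card K) := by
  have h2 : (2 : K) ≠ 0 := Ring.two_ne_zero hK
  rw [solCount_congr_add
    (g := fun p : (K × K) × (K × K) =>
      (w 0 * p.1.1 ^ 2 + w 1 * p.1.2 ^ 2) + (w 2 * p.2.1 ^ 2 + w 3 * p.2.2 ^ 2))
    ((shiftedCoords fun i => l i / (2 * w i)).trans (Equiv.prodAssoc (K × K) K K))
    (k := ∑ i, l i ^ 2 / (4 * w i)),
    solCount_four_sq hK (hw 0) (hw 1) (hw 2) (hw 3)]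
  · unfold affineQuadricSizes
    simp only [Set.mem_insert_iff, Set.mem_singleton_iff]
    rcases quadraticChar_dichotomy (neg_ne_zero.2 (mul_ne_zero (hw 0) (hw 1))) with h | h <;>
    rcases quadraticChar_dichotomy (neg_ne_zero.2 (mul_ne_zero (hw 2) (hw 3))) with h' | h' <;>
    rw [h, h'] <;> split_ifs <;> ring_nf <;> simp
  · intro x
    simp only [shiftedCoords, Equiv.trans_apply, Equiv.coe_fn_mk, Equiv.prodAssoc_apply,
      complete_square h2 (hw _), Fin.sum_univ_four]
    ring

lemma solCount_diagonal_of_eq_zero (hK : ringChar K ≠ 2) (w l : Fin 4 → K)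
    (h₀ : w 0 ≠ 0) (h₁ : w 1 ≠ 0) (h₂ : w 2 ≠ 0) (h₃ : w 3 = 0)
    (t : K) : solCount (fun x : Fin 4 → K => ∑ i, (w i * x i ^ 2 + l i * x i)) t ∈
      affineQuadricSizes (Fintype.card K) := by
  have h2 : (2 : K) ≠ 0 := Ring.two_ne_zero hK
  set f : (K × K) × K → K := fun p => w 0 * p.1.1 ^ 2 + w 1 * p.1.2 ^ 2 + w 2 * p.2 ^ 2 with hf
  rw [solCount_congr_add (g := fun p : ((K × K) × K) × K => f p.1 + l 3 * p.2)
    (shiftedCoords ![l 0 / (2 * w 0), l 1 / (2 * w 1), l 2 / (2 * w 2), 0])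
    (k := l 0 ^ 2 / (4 * w 0) + l 1 ^ 2 / (4 * w 1) + l 2 ^ 2 / (4 * w 2)),
    solCount_add f (fun x : K => l 3 * x)]
  · generalize t + _ = u
    unfold affineQuadricSizes
    simp only [Set.mem_insert_iff, Set.mem_singleton_iff]
    by_cases hl : l 3 = 0
    · have e : ∀ s : K, solCount (fun x : K => l 3 * x) s =
          if s = 0 then (Fintype.card K : ℤ) else 0 := by
        intro s
        split_ifs with hs
        · simp [solCount, hl, hs]
        · simp [solCount, hl, Ne.symm hs]
      simp only [e, sub_eq_zero, mul_ite, mul_zero, Finset.sum_ite_eq, Finset.mem_univ, if_true]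
      rw [hf, solCount_three_sq hK h₀ h₁ h₂, ← map_mul, ← map_mul]
      rcases quadraticChar_isQuadratic K (-(w 0 * w 1) * w 2 * u) with h | h | h <;>
      rw [h] <;> ring_nf <;> simp
    · simp only [solCount_linear hl, mul_one, sum_solCount]
      simp only [Nat.card_eq_fintype_card, Fintype.card_prod]
      push_cast
      ring_nf
      simp
  · intro x
    simp only [hf, shiftedCoords, Equiv.coe_fn_mk, Fin.sum_univ_four, h₃]
    simp [complete_square h2 h₀, complete_square h2 h₁, complete_square h2 h₂]
    ring

lemma solCount_diagonal (hK : ringChar K ≠ 2) (w l : Fin 4 → K)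
    (hw : ∀ i j, w i = 0 → w j = 0 → i = j) (t : K) :
    solCount (fun x : Fin 4 → K => ∑ i, (w i * x i ^ 2 + l i * x i)) t ∈
      affineQuadricSizes (Fintype.card K) := by
  by_cases h : ∃ i, w i = 0
  · obtain ⟨i, hi⟩ := h
    set σ : Equiv.Perm (Fin 4) := Equiv.swap i 3
    have hσ : ∀ j, j ≠ 3 → w (σ j) ≠ 0 := fun j hj h0 =>
      hj (by simpa [σ] using congrArg σ (hw _ _ h0 hi))
    rw [solCount_congr_add (k := 0)
      (g := fun x : Fin 4 → K => ∑ i, (w (σ i) * x i ^ 2 + l (σ i) * x i))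
      (Equiv.arrowCongr σ.symm (Equiv.refl K))]
    · exact solCount_diagonal_of_eq_zero hK (w ∘ σ) (l ∘ σ) (hσ 0 (by decide)) (hσ 1 (by decide))
        (hσ 2 (by decide)) (by simpa [σ] using hi) _
    · intro x
      simpa using Equiv.sum_comp σ fun i => w i * x i ^ 2 + l i * x i
  · exact solCount_diagonal_of_ne_zero hK w l (not_exists.1 h) t

end Counting

open QuadraticMap in
theorem solCount_quadraticForm_add_linear {K V : Type*} [Field K] [Fintype K]
    (hK : ringChar K ≠ 2) [AddCommGroup V] [Module K V] (hV : Module.finrank K V = 4)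
    (Q : QuadraticForm K V) (L : V →ₗ[K] K)
    (hQ : ∀ v w, (∀ u, polar Q u v = 0) → (∀ u, polar Q u w = 0) →
      ¬ LinearIndependent K ![v, w]) (t : K) :
    solCount (fun v => Q v + L v) t ∈ affineQuadricSizes (Fintype.card K) := by
  classical
  have h2 : (2 : K) ≠ 0 := Ring.two_ne_zero hK
  have : Invertible (2 : K) := invertibleOfNonzero h2
  have : FiniteDimensional K V := Module.finite_of_finrank_pos (by omega)
  have h := Q.equivalent_weightedSumSquares
  rw [hV] at h
  obtain ⟨w, ⟨e⟩⟩ := h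
  let E : V ≃ₗ[K] (Fin 4 → K) := e.toLinearEquiv
  have hE : ∀ x, Q (E.symm x) = ∑ i, w i * x i ^ 2 := by
    intro x
    have := e.map_app (E.symm x)
    rw [← this]
    change weightedSumSquares K w (E (E.symm x)) = _
    simp [weightedSumSquares_apply, pow_two]
  let l : Fin 4 → K := fun i => L (E.symm (Pi.single i 1))
  have hL : ∀ x, L (E.symm x) = ∑ i, l i * x i := by
    intro x
    have : x = ∑ i, x i • Pi.single i (1 : K) := by
      simpa using (pi_eq_sum_univ' x)
    conv_lhs => rw [this]
    simp [l, mul_comm]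
  rw [solCount_congr_add (k := 0) (g := fun x : Fin 4 → K => ∑ i, (w i * x i ^ 2 + l i * x i))
    E.toEquiv]
  · refine solCount_diagonal hK w l (fun i j hi hj => ?_) _
    by_contra hij
    have hr : ∀ i, w i = 0 → ∀ u, polar Q u (E.symm (Pi.single i 1)) = 0 := by
      intro i hi u
      obtain ⟨x, rfl⟩ := E.symm.surjective u
      rw [polar, ← map_add, hE, hE, hE, ← Finset.sum_sub_distrib, ← Finset.sum_sub_distrib]
      refine Finset.sum_eq_zero fun k _ => ?_
      by_cases hk : k = i
      · subst hk; simp [hi]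
      · simp [hk]
    refine hQ _ _ (hr i hi) (hr j hj) ?_
    rw [LinearIndependent.pair_iff]
    intro a b hab
    rw [← map_smul, ← map_smul, ← map_add, E.symm.map_eq_zero_iff] at hab
    have h₁ := congrFun hab i
    have h₂ := congrFun hab j
    simp [hij, Ne.symm hij] at h₁ h₂
    exact ⟨h₁, h₂⟩
  · intro v
    have h₁ := hE (E v)
    have h₂ := hL (E v)
    rw [E.symm_apply_apply] at h₁ h₂
    simp [h₁, h₂, Finset.sum_add_distrib]

/-- The coordinate `z` of the point `[1:x:y:z]` of the quadric, as a function of `(x, y)`. -/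
def quadricHeight {F : Type*} [Field F] (a b c d e f : F) (v : F × F) : F :=
  a * v.1 ^ 2 + b * v.2 ^ 2 + c * v.1 * v.2 + d * v.1 + e * v.2 + f

section Hermitian

open FiniteField

variable {K F : Type*} [Field K] [Fintype K] [Field F] [Finite F] [Algebra K F]

lemma algebraMap_trace_of_finrank_two (hF : Module.finrank K F = 2) (x : F) :
    algebraMap K F (Algebra.trace K F x) = x + frobeniusAlgHom K F x := by
  rw [algebraMap_trace_eq_sum_pow, hF]
  simp [Finset.sum_range_succ]

lemma frobenius_frobenius_of_finrank_two (hF : Module.finrank K F = 2) (x : F) :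
    frobeniusAlgHom K F (frobeniusAlgHom K F x) = x := by
  have := Fintype.ofFinite F
  have h := FiniteField.pow_card x
  rw [Module.card_eq_pow_finrank (K := K), hF] at h
  simpa [← pow_mul, ← sq] using h

lemma trace_mul_frobenius_comm (hF : Module.finrank K F = 2) (x y : F) :
    Algebra.trace K F (x * frobeniusAlgHom K F y) =
      Algebra.trace K F (y * frobeniusAlgHom K F x) := by
  apply (algebraMap K F).injective
  simp only [algebraMap_trace_of_finrank_two hF, map_mul, frobenius_frobenius_of_finrank_two hF]
  ring

lemma mem_range_algebraMap_of_frobenius_eq (hF : Module.finrank K F = 2) (h2 : (2 : K) ≠ 0)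
    {x : F} (hx : frobeniusAlgHom K F x = x) : ∃ k, algebraMap K F k = x := by
  refine ⟨Algebra.trace K F x / 2, ?_⟩
  have h2' : (2 : F) ≠ 0 := by
    rw [← map_ofNat (algebraMap K F) 2]; exact (map_ne_zero _).2 h2
  rw [map_div₀, algebraMap_trace_of_finrank_two hF, hx, map_ofNat]
  field_simp
  ring

lemma eq_zero_of_trace_mul_eq_zero {z : F} (h : ∀ u, Algebra.trace K F (u * z) = 0) : z = 0 :=
  (traceForm_nondegenerate K F).1 z fun u => by
    rw [Algebra.traceForm_apply, mul_comm]; exact h u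

variable (K) in
/-- A bilinear form on `F²` over `K` whose diagonal is twice the quadratic part of the equation
of the intersection, in the coordinates `x`, `y`. -/
noncomputable def intersectionBilin (a b c : F) : LinearMap.BilinForm K (F × F) :=
  LinearMap.mk₂ K
    (fun v w => Algebra.trace K F (2 * (a * v.1 * w.1 + b * v.2 * w.2 + c * v.1 * w.2)
      - v.1 * frobeniusAlgHom K F w.1 - v.2 * frobeniusAlgHom K F w.2))
    (fun v v' w => by rw [← map_add]; congr 1; simp only [Prod.fst_add, Prod.snd_add]; ring)
    (fun k v w => by
      rw [← map_smul]; congr 1; simp only [Prod.smul_fst, Prod.smul_snd]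
      simp only [Algebra.smul_def]; ring)
    (fun v w w' => by
      rw [← map_add]; congr 1; simp only [Prod.fst_add, Prod.snd_add, map_add]; ring)
    (fun k v w => by
      rw [← map_smul]; congr 1
      simp only [Prod.smul_fst, Prod.smul_snd, map_smul]
      simp only [Algebra.smul_def]; ring)

lemma intersectionBilin_radical (hF : Module.finrank K F = 2) (h2 : (2 : K) ≠ 0) {a b c : F}
    {w : F × F}
    (hw : ∀ u, QuadraticMap.polar (intersectionBilin K a b c).toQuadraticMap u w = 0) :
    frobeniusAlgHom K F w.1 = 2 * a * w.1 + c * w.2 ∧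
      frobeniusAlgHom K F w.2 = c * w.1 + 2 * b * w.2 := by
  have key : ∀ u₁ u₂ : F, Algebra.trace K F (u₁ * (2 * a * w.1 + c * w.2 - frobeniusAlgHom K F w.1)
      + u₂ * (c * w.1 + 2 * b * w.2 - frobeniusAlgHom K F w.2)) = 0 := by
    intro u₁ u₂
    have h := hw (u₁, u₂)
    rw [LinearMap.BilinMap.polar_toQuadraticMap] at h
    simp only [intersectionBilin, LinearMap.mk₂_apply, map_sub,
      trace_mul_frobenius_comm hF w.1, trace_mul_frobenius_comm hF w.2] at h
    refine (mul_eq_zero.1 (Eq.trans ?_ h)).resolve_left h2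
    rw [two_mul]
    simp only [← map_add, ← map_sub]
    congr 1
    ring
  constructor
  · refine (sub_eq_zero.1 (eq_zero_of_trace_mul_eq_zero (K := K) fun u => ?_)).symm
    simpa using key u 0
  · refine (sub_eq_zero.1 (eq_zero_of_trace_mul_eq_zero (K := K) fun u => ?_)).symm
    simpa using key 0 u

lemma not_linearIndependent_of_det_eq_zero (hF : Module.finrank K F = 2) (h2 : (2 : K) ≠ 0)
    {A B C D : F} {v w : F × F}
    (hv₁ : frobeniusAlgHom K F v.1 = A * v.1 + B * v.2)
    (hv₂ : frobeniusAlgHom K F v.2 = C * v.1 + D * v.2)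
    (hw₁ : frobeniusAlgHom K F w.1 = A * w.1 + B * w.2)
    (hw₂ : frobeniusAlgHom K F w.2 = C * w.1 + D * w.2)
    (hdet : v.1 * w.2 - v.2 * w.1 = 0) : ¬ LinearIndependent K ![v, w] := by
  rw [LinearIndependent.pair_iff]
  intro hli
  have hv : v ≠ 0 := by
    rintro rfl
    simpa using hli 1 0 (by simp)
  obtain ⟨r, hr⟩ : ∃ r : F, w = r • v := by
    by_cases h : v.1 = 0
    · have h' : v.2 ≠ 0 := fun h' => hv (Prod.ext h h')
      refine ⟨w.2 / v.2, Prod.ext ?_ ?_⟩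
      · have : v.2 * w.1 = 0 := by linear_combination w.2 * h - hdet
        simp [h, (mul_eq_zero.1 this).resolve_left h']
      · simp [h']
    · refine ⟨w.1 / v.1, Prod.ext ?_ ?_⟩
      · simp [h]
      · simp only [Prod.smul_snd, smul_eq_mul]
        field_simp
        linear_combination hdet
  subst hr
  simp only [Prod.smul_fst, Prod.smul_snd, smul_eq_mul, map_mul] at hw₁ hw₂
  have hr : frobeniusAlgHom K F r = r := by
    by_cases h : v.1 = 0
    · have h' : frobeniusAlgHom K F v.2 ≠ 0 :=
        (map_ne_zero (frobeniusAlgHom K F)).2 fun h' => hv (Prod.ext h h')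
      apply mul_right_cancel₀ h'
      linear_combination hw₂ - r * hv₂
    · apply mul_right_cancel₀ ((map_ne_zero (frobeniusAlgHom K F)).2 h)
      linear_combination hw₁ - r * hv₁
  obtain ⟨k, rfl⟩ := mem_range_algebraMap_of_frobenius_eq hF h2 hr
  exact neg_ne_zero.2 one_ne_zero (hli k (-1) (by rw [algebraMap_smul]; simp)).2

theorem solCount_intersection (hF : Module.finrank K F = 2) (hK : ringChar K ≠ 2)
    (a b c d e f : F) (hΔ : ¬ IsSquare (4 * a * b - c ^ 2)) :
    (Nat.card {v : F × F // quadricHeight a b c d e f v + quadricHeight a b c d e f v ^ Fintype.card K =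
      v.1 ^ (Fintype.card K + 1) + v.2 ^ (Fintype.card K + 1)} : ℤ)
      ∈ affineQuadricSizes (Fintype.card K) := by
  have h2 : (2 : K) ≠ 0 := Ring.two_ne_zero hK
  have h2F : (2 : F) ≠ 0 := by
    rw [← map_ofNat (algebraMap K F) 2]; exact (map_ne_zero _).2 h2
  have hV : Module.finrank K (F × F) = 4 := by simp [hF]
  let L : F × F →ₗ[K] K := (Algebra.trace K F) ∘ₗ
    (LinearMap.mulLeft K (2 * d)).coprod (LinearMap.mulLeft K (2 * e))
  have key := solCount_quadraticForm_add_linear hK hV (intersectionBilin K a b c).toQuadraticMap L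
    ?_ (- Algebra.trace K F (2 * f))
  · convert key using 1
    unfold solCount
    congr 1
    refine Nat.card_congr (Equiv.subtypeEquivRight fun v => ?_)
    rw [← sub_eq_zero, ← mul_right_inj' h2F, mul_zero, eq_neg_iff_add_eq_zero,
      ← (algebraMap K F).injective.eq_iff, map_zero]
    simp only [LinearMap.BilinMap.toQuadraticMap_apply, intersectionBilin, LinearMap.mk₂_apply, L,
      LinearMap.comp_apply, LinearMap.coprod_apply, LinearMap.mulLeft_apply, ← map_add]
    rw [algebraMap_trace_of_finrank_two hF]
    have hσ : ∀ x : F, x ^ Fintype.card K = frobeniusAlgHom K F x := fun x => rfl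
    rw [pow_succ v.1, pow_succ v.2, hσ, hσ, hσ, quadricHeight]
    refine Eq.congr_left ?_
    simp only [map_add, map_sub, map_mul, frobenius_frobenius_of_finrank_two hF, map_pow,
      map_ofNat]
    ring
  · intro v w hv hw
    obtain ⟨hv₁, hv₂⟩ := intersectionBilin_radical hF h2 hv
    obtain ⟨hw₁, hw₂⟩ := intersectionBilin_radical hF h2 hw
    refine not_linearIndependent_of_det_eq_zero hF h2 hv₁ hv₂ hw₁ hw₂ ?_
    by_contra hdet
    obtain ⟨m, hm⟩ : Odd (Fintype.card K) :=
      Nat.not_even_iff_odd.1 fun h => hK ((FiniteField.even_card_iff_char_two).2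
        (Nat.even_iff.1 h))
    refine hΔ ⟨(v.1 * w.2 - v.2 * w.1) ^ m, mul_right_cancel₀ hdet ?_⟩
    have h : frobeniusAlgHom K F (v.1 * w.2 - v.2 * w.1) =
        (4 * a * b - c ^ 2) * (v.1 * w.2 - v.2 * w.1) := by
      simp only [map_sub, map_mul, hv₁, hv₂, hw₁, hw₂]
      ring
    rw [← h, coe_frobeniusAlgHom, hm]
    ring

end Hermitian

section Projective

variable {F : Type} [Field F] {q : ℕ} {a b c d e f : F}

lemma hermPt_smul {r : F} (hr : r ≠ 0) (v : Fin 4 → F) : hermPt q (r • v) ↔ hermPt q v := by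
  unfold hermPt
  rw [← mul_right_inj' (pow_ne_zero (q + 1) hr) (b := v 0 ^ q * v 3 + v 0 * v 3 ^ q)]
  refine iff_of_eq (congrArg₂ _ ?_ ?_) <;> simp only [Pi.smul_apply, smul_eq_mul] <;> ring

lemma quadPt_smul {r : F} (hr : r ≠ 0) (v : Fin 4 → F) :
    quadPt a b c d e f (r • v) ↔ quadPt a b c d e f v := by
  unfold quadPt
  rw [← mul_right_inj' (pow_ne_zero 2 hr) (b := v 0 * v 3)]
  refine iff_of_eq (congrArg₂ _ ?_ ?_) <;> simp only [Pi.smul_apply, smul_eq_mul] <;> ring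

lemma hermPt_rep_mk {v : Fin 4 → F} (hv : v ≠ 0) :
    hermPt q (Projectivization.mk F v hv).rep ↔ hermPt q v := by
  obtain ⟨r, hr⟩ := Projectivization.exists_smul_eq_mk_rep F v hv
  rw [← hr]
  exact hermPt_smul r.ne_zero v

lemma quadPt_rep_mk {v : Fin 4 → F} (hv : v ≠ 0) :
    quadPt a b c d e f (Projectivization.mk F v hv).rep ↔ quadPt a b c d e f v := by
  obtain ⟨r, hr⟩ := Projectivization.exists_smul_eq_mk_rep F v hv
  rw [← hr]
  exact quadPt_smul r.ne_zero v

lemma hermPt_affine (x y z : F) :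
    hermPt q ![1, x, y, z] ↔ z + z ^ q = x ^ (q + 1) + y ^ (q + 1) := by
  simp [hermPt]

lemma quadPt_affine (x y z : F) :
    quadPt a b c d e f ![1, x, y, z] ↔ z = quadricHeight a b c d e f (x, y) := by
  simp [quadPt, quadricHeight]

/-- An elliptic quadric meets its tangent plane `j = 0` only in `[0:0:0:1]`. -/
lemma eq_zero_of_quadPt (hm : IsSquare (-1 : F)) (hΔ : ¬ IsSquare (4 * a * b - c ^ 2))
    {v : Fin 4 → F} (hv : quadPt a b c d e f v) (h₀ : v 0 = 0) : v 1 = 0 ∧ v 2 = 0 := by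
  obtain ⟨i, hi⟩ := hm
  have h : a * v 1 ^ 2 + b * v 2 ^ 2 + c * v 1 * v 2 = 0 := by
    simpa [quadPt, h₀] using hv.symm
  have h₂ : v 2 = 0 := by
    by_contra h₂
    refine hΔ ⟨i * (2 * a * v 1 + c * v 2) / v 2, ?_⟩
    field_simp
    linear_combination 4 * a * h + (2 * a * v 1 + c * v 2) ^ 2 * hi
  have h₁ : v 1 = 0 := by
    by_contra h₁
    refine hΔ ⟨i * (2 * b * v 2 + c * v 1) / v 1, ?_⟩
    field_simp
    linear_combination 4 * b * h + (2 * b * v 2 + c * v 1) ^ 2 * hi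
  exact ⟨h₁, h₂⟩

lemma card_intersection [Finite F] (hq : q ≠ 0) (hm : IsSquare (-1 : F))
    (hΔ : ¬ IsSquare (4 * a * b - c ^ 2)) :
    Nat.card {P : Projectivization F (Fin 4 → F) //
        hermPt q P.rep ∧ quadPt a b c d e f P.rep} =
      Nat.card {v : F × F // quadricHeight a b c d e f v + quadricHeight a b c d e f v ^ q =
        v.1 ^ (q + 1) + v.2 ^ (q + 1)} + 1 := by
  have ne₁ : ∀ x y z : F, ![1, x, y, z] ≠ 0 := fun x y z h => one_ne_zero (congrFun h 0)
  have ne₀ : ![(0 : F), 0, 0, 1] ≠ 0 := fun h => one_ne_zero (congrFun h 3)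
  rw [← Finite.card_option]
  symm
  refine Nat.card_congr (Equiv.ofBijective (fun o => o.elim
    ⟨Projectivization.mk F _ ne₀, (hermPt_rep_mk _).2 (by simp [hermPt, hq]),
      (quadPt_rep_mk _).2 (by simp [quadPt])⟩
    fun v => ⟨Projectivization.mk F _ (ne₁ v.1.1 v.1.2 (quadricHeight a b c d e f v.1)),
      (hermPt_rep_mk _).2 ((hermPt_affine _ _ _).2 v.2),
      (quadPt_rep_mk _).2 ((quadPt_affine _ _ _).2 rfl)⟩) ⟨?_, ?_⟩)
  · rintro (_ | v) (_ | w) h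
    · rfl
    · obtain ⟨r, hr⟩ := (Projectivization.mk_eq_mk_iff' F _ _ _ _).1 (congrArg Subtype.val h)
      have h₀ := congrFun hr 0
      have h₃ := congrFun hr 3
      simp at h₀ h₃
      simp [h₀] at h₃
    · obtain ⟨r, hr⟩ := (Projectivization.mk_eq_mk_iff' F _ _ _ _).1 (congrArg Subtype.val h)
      simpa using congrFun hr 0
    · obtain ⟨r, hr⟩ := (Projectivization.mk_eq_mk_iff' F _ _ _ _).1 (congrArg Subtype.val h)
      have h₀ := congrFun hr 0
      have h₁ := congrFun hr 1
      have h₂ := congrFun hr 2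
      simp at h₀ h₁ h₂
      simp only [h₀, one_mul] at h₁ h₂
      exact congrArg some (Subtype.ext (Prod.ext h₁.symm h₂.symm))
  · rintro ⟨P, hP⟩
    induction P using Projectivization.ind with
    | h v hv =>
    rw [hermPt_rep_mk, quadPt_rep_mk] at hP
    by_cases h₀ : v 0 = 0
    · obtain ⟨h₁, h₂⟩ := eq_zero_of_quadPt hm hΔ hP.2 h₀
      refine ⟨none, Subtype.ext ((Projectivization.mk_eq_mk_iff' F _ _ _ _).2 ⟨(v 3)⁻¹, ?_⟩)⟩
      have h₃ : v 3 ≠ 0 := by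
        intro h₃
        apply hv
        ext i
        fin_cases i <;> assumption
      ext i
      fin_cases i <;> simp [h₀, h₁, h₂, h₃]
    · have hv' : v = v 0 • ![1, v 1 / v 0, v 2 / v 0, v 3 / v 0] := by
        ext i
        fin_cases i <;> simp <;> field_simp
      rw [hv', hermPt_smul h₀, quadPt_smul h₀, hermPt_affine, quadPt_affine] at hP
      refine ⟨some ⟨(v 1 / v 0, v 2 / v 0), ?_⟩,
        Subtype.ext ((Projectivization.mk_eq_mk_iff' F _ _ _ _).2 ⟨(v 0)⁻¹, ?_⟩)⟩
      · rw [← hP.2]; exact hP.1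
      · change _ = ![1, v 1 / v 0, v 2 / v 0, quadricHeight a b c d e f (v 1 / v 0, v 2 / v 0)]
        rw [← hP.2]
        exact (inv_smul_eq_iff₀ h₀).2 hv'

end Projective

lemma exists_subfield_of_card_sq {p n : ℕ} (hp : p.Prime) (hn : 0 < n) (F : Type) [Field F]
    [Fintype F] (hF : Fintype.card F = (p ^ n) ^ 2) :
    ∃ (K : Type) (_ : Field K) (_ : Fintype K) (_ : Algebra K F),
      Fintype.card K = p ^ n ∧ Module.finrank K F = 2 := by
  have : Fact p.Prime := ⟨hp⟩
  have : CharP F p := by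
    refine charP_of_card_eq_prime_pow (f := n * 2) ?_
    rw [hF, pow_mul]
  let : Algebra (ZMod p) F := ZMod.algebra F p
  have hfin : Module.finrank (ZMod p) F = n * 2 := by
    apply Nat.pow_right_injective hp.two_le
    simp only
    rw [pow_mul, ← hF, Module.card_eq_pow_finrank (K := ZMod p) (V := F), ZMod.card]
  obtain ⟨φ⟩ := FiniteField.nonempty_algHom_of_finrank_dvd (F := ZMod p) (K := GaloisField p n)
    (L := F) (by rw [GaloisField.finrank p hn.ne', hfin]; exact dvd_mul_right n 2)
  let : Fintype (GaloisField p n) := Fintype.ofFinite _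
  let : Algebra (GaloisField p n) F := φ.toRingHom.toAlgebra
  have hcard : Fintype.card (GaloisField p n) = p ^ n := by
    rw [← Nat.card_eq_fintype_card, GaloisField.card p n hn.ne']
  refine ⟨GaloisField p n, inferInstance, inferInstance, inferInstance, hcard, ?_⟩
  have h := Module.card_eq_pow_finrank (K := GaloisField p n) (V := F)
  rw [hF, hcard] at h
  exact (Nat.pow_right_injective (Nat.one_lt_pow hn.ne' hp.one_lt) h).symm

theorem elliptic_intersection_sizes
    (q : ℕ) (hq : ∃ p n : ℕ, p.Prime ∧ Odd p ∧ 0 < n ∧ q = p ^ n)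
    (F : Type) [Field F] [Fintype F] (hF : Fintype.card F = q ^ 2)
    (a b c d e f : F)
    (hΔ : ¬ IsSquare (4 * a * b - c ^ 2)) :
    Nat.card {P : Projectivization F (Fin 4 → F) //
        hermPt q P.rep ∧ quadPt a b c d e f P.rep} ∈
      ({q ^ 3 - q ^ 2 + 1, q ^ 3 - q ^ 2 + q + 1, q ^ 3 - q + 1, q ^ 3 + 1,
        q ^ 3 + q + 1, q ^ 3 + q ^ 2 - q + 1, q ^ 3 + q ^ 2 + 1} : Set ℕ) := by
  obtain ⟨p, n, hp, hodd, hn, rfl⟩ := hq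
  obtain ⟨K, _, _, _, hK, hfin⟩ := exists_subfield_of_card_sq hp hn F hF
  have hqodd : Odd (p ^ n) := hodd.pow
  have hchar : ringChar K ≠ 2 := by
    intro h
    rw [FiniteField.even_card_iff_char_two, hK] at h
    exact Nat.not_even_iff_odd.2 hqodd (Nat.even_iff.2 h)
  have hm : IsSquare (-1 : F) := by
    rw [FiniteField.isSquare_neg_one_iff, hF]
    obtain ⟨m, hm⟩ := hqodd
    have : (p ^ n) ^ 2 = 4 * (m ^ 2 + m) + 1 := by rw [hm]; ring
    omega
  rw [card_intersection hqodd.pos.ne' hm hΔ]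
  have h := solCount_intersection hfin hchar a b c d e f hΔ
  rw [hK] at h
  generalize Nat.card _ = N at h ⊢
  generalize p ^ n = q at h ⊢ hqodd
  have hq1 : q ≤ q ^ 2 := Nat.le_self_pow two_ne_zero q
  have hq2 : q ^ 2 ≤ q ^ 3 := Nat.pow_le_pow_right hqodd.pos (by norm_num)
  simp only [affineQuadricSizes, Set.mem_insert_iff, Set.mem_singleton_iff] at h ⊢
  simp only [← Nat.cast_pow] at h
  generalize q ^ 2 = u at *
  generalize q ^ 3 = w at *
  omega
end

section
/- Suppose Δ = 4ab − c² is a nonzero square in F (so Q is a hyperbolic quadric). Then the number of points of PG(3,q²) lying on both H and Q is one of the twelve values q²+1, q³−q²+1, q³−q²+q+1, q³−q+1, q³+1, q³+q+1, q³+q²−q+1, q³+q²+1, q³+2q²−q+1, q³+2q²+1, q³+3q²−q+1, 2q³+q²+1. -/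
section Counting

theorem card_subtype_prod {X Y : Type*} [Finite X] [Fintype Y] (p : X → Y → Prop) :
    Nat.card {z : X × Y // p z.1 z.2} = ∑ y, Nat.card {x // p x y} := by
  rw [← Nat.card_sigma]
  exact Nat.card_congr
    { toFun := fun z => ⟨z.1.2, z.1.1, z.2⟩
      invFun := fun z => ⟨(z.2.1, z.1), z.2.2⟩
      left_inv := fun _ => rfl
      right_inv := fun _ => rfl }

theorem card_subtype_eq_sum {Y : Type*} [Fintype Y] (p : Y → Prop) [DecidablePred p] :
    Nat.card {y // p y} = ∑ y, if p y then 1 else 0 := by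
  rw [Nat.card_eq_fintype_card, Fintype.card_subtype, Finset.card_filter]

theorem card_subtype_congr {X Y : Type*} {p : X → Prop} {r : Y → Prop} (e : X ≃ Y)
    (h : ∀ x, p x ↔ r (e x)) : Nat.card {x // p x} = Nat.card {y // r y} :=
  Nat.card_congr (e.subtypeEquiv h)

theorem card_subtype_eq {X : Type*} (x₀ : X) : Nat.card {x : X // x = x₀} = 1 := by
  simp

theorem card_subtype_false {X : Type*} {p : X → Prop} (h : ∀ x, ¬ p x) :
    Nat.card {x // p x} = 0 := by
  have : IsEmpty {x // p x} := ⟨fun x => h x.1 x.2⟩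
  exact Nat.card_of_isEmpty

theorem card_subtype_true {X : Type*} {p : X → Prop} (h : ∀ x, p x) :
    Nat.card {x // p x} = Nat.card X :=
  Nat.card_congr (Equiv.subtypeUnivEquiv h)

/-- If all fibres of a map have at most `n` elements, its target has at most `m`, and its source
exactly `m * n`, then both bounds are attained. -/
theorem card_fiber_eq {A B : Type*} [Finite A] [Finite B] (f : A → B) {m n : ℕ}
    (hA : Nat.card A = m * n) (hB : Nat.card B ≤ m)
    (hf : ∀ b, Nat.card {a // f a = b} ≤ n) (hn : 0 < n) :
    Nat.card B = m ∧ ∀ b, Nat.card {a // f a = b} = n := by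
  have := Fintype.ofFinite B
  have h1 : ∑ b, Nat.card {a // f a = b} = m * n := by
    rw [← hA, ← Nat.card_sigma]
    exact Nat.card_congr (Equiv.sigmaFiberEquiv f)
  have h2 : ∑ b : B, Nat.card {a // f a = b} ≤ ∑ _b : B, n := Finset.sum_le_sum fun b _ => hf b
  have h3 : ∑ _b : B, n = Nat.card B * n := by simp
  have h4 : Nat.card B * n ≤ m * n := Nat.mul_le_mul_right n hB
  have h5 : Nat.card B * n = m * n := le_antisymm h4 (by rw [← h3, ← h1]; exact h2)
  refine ⟨Nat.eq_of_mul_eq_mul_right hn h5, fun b => ?_⟩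
  exact (Finset.sum_eq_sum_iff_of_le (fun b _ => hf b)).1 (by rw [h1, h3, h5]) b
    (Finset.mem_univ b)

open Polynomial in
theorem card_roots_le {R : Type*} [CommRing R] [IsDomain R] {P : R[X]} (hP : P ≠ 0) :
    Nat.card {x // P.eval x = 0} ≤ P.natDegree := by
  classical
  have h : Nat.card {x // P.eval x = 0} = P.roots.toFinset.card := by
    rw [← Nat.card_eq_finsetCard]
    exact Nat.card_congr (Equiv.subtypeEquivRight fun x => by simp [hP])
  exact h ▸ (Multiset.toFinset_card_le _).trans P.card_roots'

end Counting

section Conics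

variable {K : Type*} [Field K]

/-- The affine map `x ↦ u * x + w`. -/
def affineEquiv (u : K) (hu : u ≠ 0) (w : K) : K ≃ K :=
  (Equiv.mulLeft₀ u hu).trans (Equiv.addRight w)

@[simp]
theorem affineEquiv_apply (u : K) (hu : u ≠ 0) (w x : K) :
    affineEquiv u hu w x = u * x + w := rfl

theorem card_linear {u : K} (hu : u ≠ 0) (w : K) : Nat.card {x // u * x + w = 0} = 1 := by
  rw [← card_subtype_eq (0 : K)]
  exact card_subtype_congr (affineEquiv u hu w) fun x => by simp

theorem card_hyperbola_of_ne [Finite K] {c : K} (hc : c ≠ 0) :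
    Nat.card {z : K × K // z.1 * z.2 = c} + 1 = Nat.card K := by
  classical
  have := Fintype.ofFinite K
  rw [card_subtype_prod fun x y : K => x * y = c]
  have h : ∀ y : K, Nat.card {x // x * y = c} + (if y = 0 then 1 else 0) = 1 := by
    intro y
    by_cases hy : y = 0
    · rw [card_subtype_false (by intro x; simp [hy, hc.symm])]; simp [hy]
    · rw [if_neg hy, ← card_linear hy (-c)]
      simp only [add_zero]
      exact card_subtype_congr (Equiv.refl _) fun x => by
        rw [← sub_eq_zero, mul_comm, sub_eq_add_neg]; rfl
  have h2 := Finset.sum_congr (rfl : (Finset.univ : Finset K) = _) fun y _ => h y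
  rw [Finset.sum_add_distrib] at h2
  simpa using h2

theorem card_hyperbola_zero [Finite K] :
    Nat.card {z : K × K // z.1 * z.2 = 0} + 1 = 2 * Nat.card K := by
  classical
  have := Fintype.ofFinite K
  rw [card_subtype_prod fun x y : K => x * y = 0]
  have h : ∀ y : K, Nat.card {x // x * y = 0} + (if y = 0 then 1 else 0)
      = 1 + if y = 0 then Nat.card K else 0 := by
    intro y
    by_cases hy : y = 0
    · rw [card_subtype_true (by intro x; simp [hy])]; simp [hy, add_comm]
    · simp [hy]
  have h2 := Finset.sum_congr (rfl : (Finset.univ : Finset K) = _) fun y _ => h y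
  rw [Finset.sum_add_distrib, Finset.sum_add_distrib] at h2
  simp only [Finset.sum_ite_eq', Finset.mem_univ, if_true, Finset.sum_const, Finset.card_univ,
    ← Nat.card_eq_fintype_card, smul_eq_mul, mul_one] at h2
  omega

theorem card_sqrt (c : K) :
    Nat.card {x // x ^ 2 = c} = 0 ∨ Nat.card {x // x ^ 2 = c} = 1 ∨
      Nat.card {x // x ^ 2 = c} = 2 := by
  have hP : (Polynomial.X ^ 2 - Polynomial.C c) ≠ 0 := Polynomial.X_pow_sub_C_ne_zero two_pos c
  have h := card_roots_le hP
  rw [Polynomial.natDegree_X_pow_sub_C] at h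
  simp only [Polynomial.eval_sub, Polynomial.eval_pow, Polynomial.eval_X, Polynomial.eval_C,
    sub_eq_zero] at h
  omega

/-- The number of roots of a quadratic polynomial with nonzero leading coefficient. -/
theorem card_quadratic_le {a : K} (ha : a ≠ 0) (b c : K) :
    Nat.card {x // a * x ^ 2 + b * x + c = 0} ≤ 2 := by
  have h := Polynomial.natDegree_quadratic (b := b) (c := c) ha
  have hP : (Polynomial.C a * Polynomial.X ^ 2 + Polynomial.C b * Polynomial.X
      + Polynomial.C c) ≠ 0 := by
    intro h0; rw [h0] at h; simp at h
  have h' := card_roots_le hP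
  rw [h] at h'
  simpa using h'

theorem card_affine_line (b c : K) :
    Nat.card {x // b * x + c = 0} = 0 ∨ Nat.card {x // b * x + c = 0} = 1 ∨
      Nat.card {x // b * x + c = 0} = Nat.card K := by
  by_cases hb : b = 0
  · by_cases hc : c = 0
    · right; right; exact card_subtype_true (by simp [hb, hc])
    · left; exact card_subtype_false (by simp [hb, hc])
  · right; left; exact card_linear hb c

/-- The possible numbers of zeros in the affine plane over a field with `n` elements of a polynomial
of degree at most two. -/
def IsConicCard (n N : ℕ) : Prop :=
  N = 0 ∨ N = 1 ∨ N + 1 = n ∨ N = n ∨ N = n + 1 ∨ N + 1 = 2 * n ∨ N = 2 * n ∨ N = n ^ 2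

/-- The number of points of the anisotropic conics over `K`. -/
def AnisotropicCount (K : Type*) [Field K] : Prop :=
  ∀ a : K, ¬ IsSquare a → ∀ c : K, Nat.card {z : K × K // z.2 ^ 2 - a * z.1 ^ 2 = c} = 1 ∨
    Nat.card {z : K × K // z.2 ^ 2 - a * z.1 ^ 2 = c} = Nat.card K + 1

theorem isConicCard_diagonal [Finite K] (h2 : (2 : K) ≠ 0) (hK : AnisotropicCount K)
    {a : K} (ha : a ≠ 0) (c : K) : IsConicCard (Nat.card K) (Nat.card {z : K × K // z.2 ^ 2 - a * z.1 ^ 2 = c}) := by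
  unfold IsConicCard
  by_cases hsq : IsSquare a
  · obtain ⟨m, rfl⟩ := hsq
    have hm : m ≠ 0 := by rintro rfl; simp at ha
    have e : Nat.card {z : K × K // z.2 ^ 2 - m * m * z.1 ^ 2 = c}
        = Nat.card {z : K × K // z.1 * z.2 = c} := by
      refine card_subtype_congr
        { toFun := fun z => (z.2 - m * z.1, z.2 + m * z.1)
          invFun := fun z => ((z.2 - z.1) / (2 * m), (z.1 + z.2) / 2)
          left_inv := fun z => ?_
          right_inv := fun z => ?_ } fun z => ?_
      · ext <;> field_simp <;> ring
      · ext <;> field_simp <;> ring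
      · simp only [Equiv.coe_fn_mk]; ring_nf
    rw [e]
    by_cases hc : c = 0
    · have := card_hyperbola_zero (K := K); subst hc; tauto
    · have := card_hyperbola_of_ne hc; tauto
  · have := hK a hsq c; tauto

theorem isConicCard_sq [Finite K] (h2 : (2 : K) ≠ 0) (hK : AnisotropicCount K) (a b c : K) :
    IsConicCard (Nat.card K)
      (Nat.card {z : K × K // z.1 ^ 2 = a * z.2 ^ 2 + b * z.2 + c}) := by
  classical
  have := Fintype.ofFinite K
  by_cases ha : a = 0
  · subst ha
    unfold IsConicCard
    by_cases hb : b = 0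
    · subst hb
      rw [card_subtype_prod fun x y : K => x ^ 2 = 0 * y ^ 2 + 0 * y + c]
      simp only [zero_mul, zero_add, Finset.sum_const, Finset.card_univ,
        ← Nat.card_eq_fintype_card, smul_eq_mul]
      rcases card_sqrt c with h | h | h <;> rw [h] <;> simp [mul_comm]
    · have e : Nat.card {z : K × K // z.1 ^ 2 = 0 * z.2 ^ 2 + b * z.2 + c}
          = Nat.card {z : K × K // b * z.1 + (c - z.2 ^ 2) = 0} :=
        card_subtype_congr (Equiv.prodComm K K) fun z => by
          simp only [Equiv.prodComm_apply, Prod.fst_swap, Prod.snd_swap]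
          constructor <;> intro h <;> linear_combination -h
      rw [e, card_subtype_prod fun x y : K => b * x + (c - y ^ 2) = 0]
      simp only [card_linear hb, Finset.sum_const, Finset.card_univ, ← Nat.card_eq_fintype_card,
        smul_eq_mul, mul_one, true_or, or_true]
  · have h4 : (4 : K) ≠ 0 := by
      have : (4 : K) = 2 * 2 := by norm_num
      rw [this]; exact mul_ne_zero h2 h2
    have e : Nat.card {z : K × K // z.1 ^ 2 = a * z.2 ^ 2 + b * z.2 + c}
        = Nat.card {z : K × K // z.2 ^ 2 - a * z.1 ^ 2 = b ^ 2 - 4 * a * c} := by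
      refine card_subtype_congr
        ((affineEquiv 2 h2 0).prodCongr (affineEquiv (2 * a) (mul_ne_zero h2 ha) b)) fun z => ?_
      simp only [Equiv.prodCongr_apply, Prod.map, affineEquiv_apply]
      constructor
      · intro h; linear_combination -4 * a * h
      · intro h
        apply mul_left_cancel₀ (mul_ne_zero h4 ha)
        linear_combination -h
    rw [e]
    exact isConicCard_diagonal h2 hK ha _

theorem isConicCard_of_ne [Finite K] (h2 : (2 : K) ≠ 0) (hK : AnisotropicCount K)
    {A : K} (hA : A ≠ 0) (B C D E G : K) :
    IsConicCard (Nat.card K) (Nat.card {z : K × K //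
      A * z.1 ^ 2 + B * z.1 * z.2 + C * z.2 ^ 2 + D * z.1 + E * z.2 + G = 0}) := by
  have := Fintype.ofFinite K
  have h4 : (4 : K) ≠ 0 := by
    have : (4 : K) = 2 * 2 := by norm_num
    rw [this]; exact mul_ne_zero h2 h2
  have h := isConicCard_sq h2 hK (B ^ 2 - 4 * A * C) (2 * B * D - 4 * A * E) (D ^ 2 - 4 * A * G)
  rw [card_subtype_prod fun x y : K => x ^ 2 = (B ^ 2 - 4 * A * C) * y ^ 2
    + (2 * B * D - 4 * A * E) * y + (D ^ 2 - 4 * A * G)] at h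
  rw [card_subtype_prod fun x y : K =>
    A * x ^ 2 + B * x * y + C * y ^ 2 + D * x + E * y + G = 0]
  refine (congrArg _ (Finset.sum_congr rfl fun y _ => ?_)).mp h
  symm
  refine card_subtype_congr (affineEquiv (2 * A) (mul_ne_zero h2 hA) (B * y + D)) fun x => ?_
  rw [affineEquiv_apply]
  constructor
  · intro h; linear_combination 4 * A * h
  · intro h
    apply mul_left_cancel₀ (mul_ne_zero h4 hA)
    linear_combination h

theorem isConicCard_quadratic [Finite K] (h2 : (2 : K) ≠ 0) (hK : AnisotropicCount K)
    (A B C D E G : K) :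
    IsConicCard (Nat.card K) (Nat.card {z : K × K //
      A * z.1 ^ 2 + B * z.1 * z.2 + C * z.2 ^ 2 + D * z.1 + E * z.2 + G = 0}) := by
  have := Fintype.ofFinite K
  by_cases hA : A = 0
  swap
  · exact isConicCard_of_ne h2 hK hA B C D E G
  by_cases hC : C = 0
  swap
  · convert isConicCard_of_ne h2 hK hC B A E D G using 1
    exact card_subtype_congr (Equiv.prodComm K K) fun z => by
      simp only [Equiv.prodComm_apply, Prod.fst_swap, Prod.snd_swap]
      constructor <;> intro h <;> linear_combination h
  subst hA hC
  unfold IsConicCard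
  by_cases hB : B = 0
  · subst hB
    by_cases hD : D = 0
    · subst hD
      by_cases hE : E = 0
      · subst hE
        by_cases hG : G = 0
        · rw [card_subtype_true (by simp [hG]), Nat.card_prod, ← sq]; tauto
        · rw [card_subtype_false (by simp [hG])]; tauto
      · rw [← card_subtype_congr (Equiv.prodComm K K)
          (p := fun z => E * z.1 + G = 0) (by simp),
          card_subtype_prod fun x _ : K => E * x + G = 0]
        simp [card_linear hE]
    · rw [← card_subtype_congr (Equiv.refl (K × K))
        (p := fun z => D * z.1 + (E * z.2 + G) = 0) (by simp [add_assoc]),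
        card_subtype_prod fun x y : K => D * x + (E * y + G) = 0]
      simp [card_linear hD]
  · have e : Nat.card {z : K × K //
        0 * z.1 ^ 2 + B * z.1 * z.2 + 0 * z.2 ^ 2 + D * z.1 + E * z.2 + G = 0}
        = Nat.card {z : K × K // z.1 * z.2 = D * E - B * G} :=
      card_subtype_congr ((affineEquiv B hB E).prodCongr (affineEquiv B hB D)) fun z => by
        simp only [Equiv.prodCongr_apply, Prod.map, affineEquiv_apply]
        constructor
        · intro h; linear_combination B * h
        · intro h
          apply mul_left_cancel₀ hB
          linear_combination h
    rw [e]
    by_cases hc : D * E - B * G = 0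
    · have := card_hyperbola_zero (K := K); rw [hc]; tauto
    · have := card_hyperbola_of_ne hc; tauto

end Conics

section Conjugation

/-- `σ` is the involution `x ↦ x ^ q` of a field of odd characteristic with `q ^ 2` elements. -/
structure IsQuadraticConj {F : Type*} [Field F] (q : ℕ) (σ : F →+* F) : Prop where
  apply_eq : ∀ x, σ x = x ^ q
  card_eq : Nat.card F = q ^ 2
  two_ne : (2 : F) ≠ 0

/-- The subfield fixed by `σ`. -/
abbrev fixedBy {F : Type*} [Field F] (σ : F →+* F) : Subfield F :=
  σ.eqLocusField (RingHom.id F)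

variable {F : Type*} [Field F] {q : ℕ} {σ : F →+* F}

theorem mem_fixedBy {x : F} : x ∈ fixedBy σ ↔ σ x = x := Iff.rfl

namespace IsQuadraticConj

theorem two_le [Finite F] (h : IsQuadraticConj q σ) : 2 ≤ q := by
  have h1 : 1 < Nat.card F := Finite.one_lt_card
  rw [h.card_eq] at h1
  by_contra! h2
  interval_cases q <;> simp at h1

theorem card_norm_zero : Nat.card {u // u * σ u = 0} = 1 := by
  rw [← card_subtype_eq (0 : F)]
  exact Nat.card_congr (Equiv.subtypeEquivRight fun u => by simp)

theorem two_ne_fixed (h : IsQuadraticConj q σ) : (2 : fixedBy σ) ≠ 0 := by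
  intro h0
  exact h.two_ne (congrArg Subtype.val h0)

variable [Finite F]

theorem conj_conj (h : IsQuadraticConj q σ) (x : F) : σ (σ x) = x := by
  have := Fintype.ofFinite F
  rw [h.apply_eq, h.apply_eq, ← pow_mul, ← sq, ← h.card_eq, Nat.card_eq_fintype_card,
    FiniteField.pow_card]

theorem card_fixedBy_le (h : IsQuadraticConj q σ) : Nat.card (fixedBy σ) ≤ q := by
  have hq := h.two_le
  have hd := FiniteField.X_pow_card_sub_X_natDegree_eq F (p := q) (by omega)
  have h1 := card_roots_le (FiniteField.X_pow_card_sub_X_ne_zero F (p := q) (by omega))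
  rw [hd] at h1
  refine le_of_eq_of_le (Nat.card_congr (Equiv.subtypeEquivRight fun x => ?_)) h1
  rw [mem_fixedBy, h.apply_eq]
  simp [sub_eq_zero]

theorem card_fixedBy_and_card_trace (h : IsQuadraticConj q σ) :
    Nat.card (fixedBy σ) = q ∧ ∀ b : F, σ b = b → Nat.card {u // u + σ u = b} = q := by
  have hq := h.two_le
  let f : F → fixedBy σ := fun u => ⟨u + σ u, by
    rw [mem_fixedBy, map_add, h.conj_conj, add_comm]⟩
  have hf : ∀ u (b : fixedBy σ), f u = b ↔ u + σ u = b := fun u b => Subtype.ext_iff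
  have key := card_fiber_eq f (m := q) (n := q) (by rw [h.card_eq, sq]) h.card_fixedBy_le ?_
    (by omega)
  · refine ⟨key.1, fun b hb => ?_⟩
    rw [← key.2 ⟨b, hb⟩]
    exact Nat.card_congr (Equiv.subtypeEquivRight fun x => (hf x ⟨b, hb⟩).symm)
  · intro b
    have hd : (Polynomial.X ^ q + (Polynomial.X - Polynomial.C (b : F))).natDegree = q := by
      rw [Polynomial.natDegree_add_eq_left_of_natDegree_lt] <;>
        simp only [Polynomial.natDegree_X_pow, Polynomial.natDegree_X_sub_C]
      omega
    have h1 := card_roots_le (P := Polynomial.X ^ q + (Polynomial.X - Polynomial.C (b : F)))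
      (by intro h0; rw [h0] at hd; simp at hd; omega)
    rw [hd] at h1
    refine le_of_eq_of_le (Nat.card_congr (Equiv.subtypeEquivRight fun x => ?_)) h1
    rw [hf, h.apply_eq, ← sub_eq_zero]
    simp only [Polynomial.eval_add, Polynomial.eval_sub, Polynomial.eval_pow, Polynomial.eval_X,
      Polynomial.eval_C]
    ring_nf

theorem card_fixedBy (h : IsQuadraticConj q σ) : Nat.card (fixedBy σ) = q :=
  h.card_fixedBy_and_card_trace.1

theorem card_trace (h : IsQuadraticConj q σ) {b : F} (hb : σ b = b) :
    Nat.card {u // u + σ u = b} = q :=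
  h.card_fixedBy_and_card_trace.2 b hb

theorem card_trace_mul (h : IsQuadraticConj q σ) {b w : F} (hb : σ b = b) (hw : w ≠ 0) :
    Nat.card {u // u * w + σ (u * w) = b} = q := by
  rw [← h.card_trace hb]
  exact card_subtype_congr (Equiv.mulRight₀ w hw) fun x => by simp

theorem card_norm (h : IsQuadraticConj q σ) {b : F} (hb : σ b = b) (hb0 : b ≠ 0) :
    Nat.card {u // u * σ u = b} = q + 1 := by
  have hq := h.two_le
  let f : Fˣ → (fixedBy σ)ˣ := fun u => Units.mk0 ⟨u * σ u, by
    rw [mem_fixedBy, map_mul, h.conj_conj, mul_comm]⟩ (by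
      intro h0
      have := congrArg Subtype.val h0
      simp at this)
  have hf : ∀ u (b : (fixedBy σ)ˣ), f u = b ↔ (u : F) * σ u = ((b : fixedBy σ) : F) := fun u b => by
    rw [Units.ext_iff, Subtype.ext_iff]; rfl
  have key := card_fiber_eq f (m := q - 1) (n := q + 1) ?_ ?_ ?_ (by omega)
  · rw [← key.2 (Units.mk0 ⟨b, hb⟩ (by simpa [Subtype.ext_iff] using hb0))]
    refine Nat.card_congr
      { toFun := fun u => ⟨Units.mk0 u.1 ?_, ?_⟩
        invFun := fun u => ⟨u.1, (hf _ _).1 u.2⟩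
        left_inv := fun u => ?_
        right_inv := fun u => ?_ }
    · intro h0; apply hb0; rw [← u.2, h0, zero_mul]
    · rw [hf]; exact u.2
    · rfl
    · ext; rfl
  · rw [Nat.card_units, h.card_eq]
    obtain ⟨k, rfl⟩ := Nat.exists_eq_add_of_le hq
    have : 2 + k - 1 = k + 1 := by omega
    rw [this, Nat.sub_eq_iff_eq_add (Nat.one_le_pow _ _ (by omega))]
    ring
  · rw [Nat.card_units, h.card_fixedBy]
  · intro b
    have h1 := card_roots_le (Polynomial.X_pow_sub_C_ne_zero (n := q + 1) (by omega)
      ((b : fixedBy σ) : F))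
    rw [Polynomial.natDegree_X_pow_sub_C] at h1
    refine le_trans ?_ h1
    refine Nat.card_le_card_of_injective (fun u => ⟨(u.1 : F), ?_⟩) ?_
    · have := (hf _ _).1 u.2
      rw [h.apply_eq] at this
      simp [pow_succ', this]
    · intro u v huv
      have := congrArg Subtype.val huv
      exact Subtype.ext (Units.ext this)

/-- Coordinates of `F` over the fixed field with respect to the basis `1, ε`. -/
noncomputable def coordEquiv (h : IsQuadraticConj q σ) {ε : F} (hε : σ ε = -ε) (hε0 : ε ≠ 0) :
    fixedBy σ × fixedBy σ ≃ F :=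
  Equiv.ofBijective (fun z => z.1 + z.2 * ε) <| by
    rw [Nat.bijective_iff_injective_and_card]
    refine ⟨fun z w hzw => ?_, by rw [Nat.card_prod, h.card_fixedBy, h.card_eq, sq]⟩
    have h1 : (z.1 : F) + z.2 * ε = w.1 + w.2 * ε := hzw
    have h2 := congrArg σ h1
    simp only [map_add, map_mul, hε, mem_fixedBy.1 z.1.2, mem_fixedBy.1 z.2.2,
      mem_fixedBy.1 w.1.2, mem_fixedBy.1 w.2.2] at h2
    have h3 : (z.1 : F) = w.1 := mul_left_cancel₀ h.two_ne (by linear_combination h1 + h2)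
    have h4 : (z.2 : F) = w.2 := mul_right_cancel₀ hε0 (by linear_combination h1 - h3)
    exact Prod.ext (Subtype.ext h3) (Subtype.ext h4)

theorem coordEquiv_apply (h : IsQuadraticConj q σ) {ε : F} (hε : σ ε = -ε) (hε0 : ε ≠ 0)
    (z : fixedBy σ × fixedBy σ) : h.coordEquiv hε hε0 z = z.1 + z.2 * ε := rfl

theorem exists_anti (h : IsQuadraticConj q σ) : ∃ ε : F, σ ε = -ε ∧ ε ≠ 0 := by
  by_contra! hc
  have h1 := h.card_trace (b := 0) (map_zero σ)
  have h2 : Nat.card {u : F // u + σ u = 0} = 1 := by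
    rw [← card_subtype_eq (0 : F)]
    refine Nat.card_congr (Equiv.subtypeEquivRight fun u => ⟨fun hu => ?_, ?_⟩)
    · exact hc u (by linear_combination hu)
    · rintro rfl; simp
  have := h.two_le
  omega

theorem exists_sq_of_fixed (h : IsQuadraticConj q σ) {a : F} (ha : σ a = a) : IsSquare a := by
  have := Fintype.ofFinite F
  by_cases ha0 : a = 0
  · subst ha0; exact IsSquare.zero
  have hodd : Odd (Nat.card F) := by
    rw [Nat.card_eq_fintype_card]
    refine Nat.odd_iff.2 (FiniteField.odd_card_of_char_ne_two fun h2 => h.two_ne ?_)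
    have := CharP.cast_eq_zero F (ringChar F)
    rw [h2] at this
    exact_mod_cast this
  rw [h.card_eq, Nat.odd_pow_iff two_ne_zero] at hodd
  obtain ⟨k, hk⟩ := hodd
  have h1 := h.card_norm ha ha0
  have : Nonempty {u // u * σ u = a} := (Nat.card_pos_iff.1 (by omega)).1
  obtain ⟨u, hu⟩ := this
  refine ⟨u ^ (k + 1), ?_⟩
  rw [← hu, h.apply_eq, hk]
  ring

theorem anisotropicCount (h : IsQuadraticConj q σ) : AnisotropicCount (fixedBy σ) := by
  intro a ha c
  obtain ⟨η, hη⟩ := h.exists_sq_of_fixed a.2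
  have hη0 : η ≠ 0 := by
    rintro rfl
    exact ha ⟨0, Subtype.ext (by simpa using hη)⟩
  have hs : σ η = -η := by
    have h1 : σ η * σ η = η * η := by rw [← map_mul, ← hη, mem_fixedBy.1 a.2]
    rcases mul_self_eq_mul_self_iff.1 h1 with h1 | h1
    · exact absurd ⟨⟨η, h1⟩, Subtype.ext hη⟩ ha
    · exact h1
  have e : Nat.card {z : fixedBy σ × fixedBy σ // z.2 ^ 2 - a * z.1 ^ 2 = c}
      = Nat.card {u : F // u * σ u = c} := by
    refine card_subtype_congr ((Equiv.prodComm _ _).trans (h.coordEquiv hs hη0)) fun z => ?_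
    rw [Equiv.trans_apply, coordEquiv_apply, Subtype.ext_iff]
    simp only [Equiv.prodComm_apply, Prod.fst_swap, Prod.snd_swap, map_add, map_mul, hs,
      mem_fixedBy.1 z.1.2, mem_fixedBy.1 z.2.2]
    push_cast
    rw [hη]
    constructor <;> intro h <;> linear_combination h
  rw [e, h.card_fixedBy]
  by_cases hc : c = 0
  · left; subst hc; exact card_norm_zero
  · right; exact h.card_norm (mem_fixedBy.1 c.2) fun h0 => hc (Subtype.ext h0)

end IsQuadraticConj

end Conjugation

section AffinePart

variable {F : Type*} [Field F] [Finite F] {q : ℕ} {σ : F →+* F}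

/-- The affine equation of the intersection, in coordinates in which the quadric is
`z = u * v + d * u + e * v + f` and `g` is the trace of `f`. -/
def AffineEq (σ : F →+* F) (α β γ d e g u v : F) : Prop :=
  u * v + d * u + e * v + σ (u * v + d * u + e * v) + g =
    α * (u * σ u) + γ * (v * σ v) + (β * (u * σ v) + σ (β * (u * σ v)))

namespace IsQuadraticConj

theorem card_affineEq_swap (h : IsQuadraticConj q σ) (α β γ d e g : F) :
    Nat.card {z : F × F // AffineEq σ α β γ d e g z.1 z.2} =
      Nat.card {z : F × F // AffineEq σ γ (σ β) α e d g z.1 z.2} :=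
  card_subtype_congr (Equiv.prodComm F F) fun z => by
    simp only [AffineEq, Equiv.prodComm_apply, Prod.fst_swap, Prod.snd_swap, map_mul, map_add,
      h.conj_conj]
    constructor <;> intro h <;> linear_combination h

theorem card_affineEq_add (h : IsQuadraticConj q σ) {β γ d e g : F} (hγ : σ γ = γ)
    (hg : σ g = g) :
    Nat.card {z : F × F // AffineEq σ 0 β γ d e g z.1 z.2} +
        q * Nat.card {v // v + d - β * σ v = 0} =
      q ^ 3 + q ^ 2 * Nat.card {v // v + d - β * σ v = 0 ∧
        γ * (v * σ v) - g - (e * v + σ (e * v)) = 0} := by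
  classical
  have := Fintype.ofFinite F
  rw [card_subtype_prod, card_subtype_eq_sum, card_subtype_eq_sum, Finset.mul_sum, Finset.mul_sum,
    ← Finset.sum_add_distrib]
  have hF : q ^ 3 = ∑ _v : F, q := by
    rw [Finset.sum_const, Finset.card_univ, ← Nat.card_eq_fintype_card, h.card_eq, smul_eq_mul]
    ring
  rw [hF, ← Finset.sum_add_distrib]
  refine Finset.sum_congr rfl fun v _ => ?_
  have e1 : ∀ u, AffineEq σ 0 β γ d e g u v ↔
      u * (v + d - β * σ v) + σ (u * (v + d - β * σ v)) =
        γ * (v * σ v) - g - (e * v + σ (e * v)) := fun u => by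
    simp only [AffineEq, map_mul, map_add, map_sub, h.conj_conj]
    constructor <;> intro h <;> linear_combination h
  have ht : σ (γ * (v * σ v) - g - (e * v + σ (e * v))) =
      γ * (v * σ v) - g - (e * v + σ (e * v)) := by
    simp only [map_mul, map_add, map_sub, h.conj_conj, hγ, hg]
    ring
  simp only [e1]
  by_cases hw : v + d - β * σ v = 0
  · by_cases ht0 : γ * (v * σ v) - g - (e * v + σ (e * v)) = 0
    · rw [card_subtype_true (by intro u; rw [hw, ht0]; simp), h.card_eq]
      simp only [hw, ht0, and_self, if_true]
      ring
    · rw [card_subtype_false (by intro u; rw [hw]; simpa using Ne.symm ht0)]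
      simp only [hw, ht0, and_false, if_true, if_false]
      ring
  · rw [h.card_trace_mul ht hw]
    simp [hw]

/-- The number of affine points when the equation has no term `u * σ u`. -/
theorem card_affineEq_of_zero (h : IsQuadraticConj q σ) {β γ d e g : F} (hγ : σ γ = γ)
    (hg : σ g = g) {N : ℕ} (hN : N = Nat.card {z : F × F // AffineEq σ 0 β γ d e g z.1 z.2}) :
    N = q ^ 3 ∨ N + q = q ^ 3 ∨ N + q = q ^ 3 + q ^ 2 ∨ N + q ^ 2 = q ^ 3 ∨
      (γ ≠ 0 ∧ N = q ^ 3 + q ^ 2) ∨ (γ = 0 ∧ N + q ^ 2 = 2 * q ^ 3) := by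
  have key := h.card_affineEq_add (β := β) (d := d) (e := e) hγ hg
  rw [← hN] at key
  by_cases hS : ∃ v₀, v₀ + d - β * σ v₀ = 0
  swap
  · push Not at hS
    rw [card_subtype_false hS, card_subtype_false fun v hv => hS v hv.1] at key
    left; simpa using key
  obtain ⟨v₀, hv₀⟩ := hS
  by_cases hker : ∃ v₁, v₁ = β * σ v₁ ∧ v₁ ≠ 0
  swap
  · push Not at hker
    have huniq : ∀ v, v + d - β * σ v = 0 ↔ v = v₀ := fun v => by
      refine ⟨fun hv => sub_eq_zero.1 (hker _ ?_), fun hv => hv ▸ hv₀⟩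
      rw [map_sub]; linear_combination hv - hv₀
    simp only [huniq, card_subtype_eq] at key
    by_cases ht : γ * (v₀ * σ v₀) - g - (e * v₀ + σ (e * v₀)) = 0
    · rw [Nat.card_congr (Equiv.subtypeEquivRight (q := fun v => v = v₀)
        fun v => ⟨fun hv => hv.1, fun hv => ⟨hv, hv ▸ ht⟩⟩), card_subtype_eq] at key
      right; right; left; simpa using key
    · rw [card_subtype_false fun v (hv : v = v₀ ∧ _) => ht (hv.1 ▸ hv.2)] at key
      right; left; simpa using key
  obtain ⟨v₁, hv₁, hv₁0⟩ := hker
  have hβ : β ≠ 0 := by rintro rfl; simp at hv₁; exact hv₁0 hv₁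
  let E : fixedBy σ ≃ {v // v + d - β * σ v = 0} :=
    { toFun := fun s => ⟨v₀ + s * v₁, by
        rw [map_add, map_mul, mem_fixedBy.1 s.2]; linear_combination hv₀ + s * hv₁⟩
      invFun := fun v => ⟨(v - v₀) / v₁, by
        have h1 : (v : F) - v₀ = β * (σ v - σ v₀) := by linear_combination v.2 - hv₀
        have h2 : σ v₁ ≠ 0 := by simpa using hv₁0
        rw [mem_fixedBy, map_div₀, map_sub, div_eq_div_iff h2 hv₁0]
        apply mul_left_cancel₀ hβ
        linear_combination (-v₁) * h1 + ((v : F) - v₀) * hv₁⟩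
      left_inv := fun s => Subtype.ext (by
        change (v₀ + s * v₁ - v₀) / v₁ = s
        field_simp; ring)
      right_inv := fun v => Subtype.ext (by
        change v₀ + (v - v₀) / v₁ * v₁ = v
        field_simp; ring) }
  have hcard : Nat.card {v // v + d - β * σ v = 0} = q := by
    rw [← Nat.card_congr E, h.card_fixedBy]
  let A : fixedBy σ := ⟨γ * (v₁ * σ v₁), by
    rw [mem_fixedBy]; simp only [map_mul, h.conj_conj, hγ]; ring⟩
  let B : fixedBy σ := ⟨γ * (v₀ * σ v₁ + v₁ * σ v₀) - (e * v₁ + σ (e * v₁)), by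
    rw [mem_fixedBy]; simp only [map_mul, map_add, map_sub, h.conj_conj, hγ]; ring⟩
  let C : fixedBy σ := ⟨γ * (v₀ * σ v₀) - g - (e * v₀ + σ (e * v₀)), by
    rw [mem_fixedBy]; simp only [map_mul, map_add, map_sub, h.conj_conj, hγ, hg]; ring⟩
  have hS0 : Nat.card {v // v + d - β * σ v = 0 ∧
        γ * (v * σ v) - g - (e * v + σ (e * v)) = 0} =
      Nat.card {s : fixedBy σ // A * s ^ 2 + B * s + C = 0} := by
    rw [← Nat.card_congr (Equiv.subtypeSubtypeEquivSubtypeInter _ _)]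
    symm
    refine card_subtype_congr E fun s => ?_
    rw [Subtype.ext_iff]
    change γ * (v₁ * σ v₁) * (s : F) ^ 2 +
      (γ * (v₀ * σ v₁ + v₁ * σ v₀) - (e * v₁ + σ (e * v₁))) * s +
      (γ * (v₀ * σ v₀) - g - (e * v₀ + σ (e * v₀))) = 0 ↔
      γ * ((v₀ + s * v₁) * σ (v₀ + s * v₁)) - g - (e * (v₀ + s * v₁) + σ (e * (v₀ + s * v₁))) = 0
    simp only [map_mul, map_add, mem_fixedBy.1 s.2]
    constructor <;> intro h <;> linear_combination h
  rw [hcard, hS0] at key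
  by_cases hγ0 : γ = 0
  · have hA : A = 0 := Subtype.ext (by simp [A, hγ0])
    rw [hA] at key
    simp only [zero_mul, zero_add] at key
    rcases card_affine_line B C with h1 | h1 | h1 <;> rw [h1] at key
    · right; right; right; left; linarith
    · left; linarith
    · rw [h.card_fixedBy] at key
      right; right; right; right; right
      exact ⟨hγ0, by linarith⟩
  · have hA : A ≠ 0 := fun h0 => by
      have h1 : γ * (v₁ * σ v₁) = 0 := congrArg Subtype.val h0
      simp [hγ0, hv₁0] at h1
    have h1 := card_quadratic_le hA B C
    interval_cases Nat.card {s : fixedBy σ // A * s ^ 2 + B * s + C = 0}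
    · right; right; right; left; linarith
    · left; linarith
    · right; right; right; right; left
      exact ⟨hγ0, by linarith⟩

theorem card_affineEq_add_of_ne (h : IsQuadraticConj q σ) {α β γ d e g : F} (hα : σ α = α)
    (hγ : σ γ = γ) (hg : σ g = g) (hα0 : α ≠ 0) :
    Nat.card {z : F × F // AffineEq σ α β γ d e g z.1 z.2} +
        q * Nat.card {v // (v + d - β * σ v) * σ (v + d - β * σ v) +
          α * (e * v + σ (e * v) + g - γ * (v * σ v)) = 0} =
      q ^ 3 + q ^ 2 := by
  classical
  have := Fintype.ofFinite F
  rw [card_subtype_prod, card_subtype_eq_sum, Finset.mul_sum, ← Finset.sum_add_distrib]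
  have hF : q ^ 3 + q ^ 2 = ∑ _v : F, (q + 1) := by
    rw [Finset.sum_const, Finset.card_univ, ← Nat.card_eq_fintype_card, h.card_eq, smul_eq_mul]
    ring
  rw [hF]
  refine Finset.sum_congr rfl fun v _ => ?_
  set R := (v + d - β * σ v) * σ (v + d - β * σ v) +
          α * (e * v + σ (e * v) + g - γ * (v * σ v)) with hR
  have hRσ : σ R = R := by
    simp only [hR, map_mul, map_add, map_sub, h.conj_conj, hγ, hg, hα]
    ring
  have e1 : Nat.card {u // AffineEq σ α β γ d e g u v} = Nat.card {u // u * σ u = R} := by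
    refine card_subtype_congr (affineEquiv α hα0 (-σ (v + d - β * σ v))) fun u => ?_
    rw [affineEquiv_apply, hR]
    simp only [AffineEq, map_mul, map_add, map_sub, map_neg, h.conj_conj, hα]
    constructor
    · intro h; linear_combination -α * h
    · intro h
      apply mul_left_cancel₀ hα0
      linear_combination -h
  rw [e1]
  by_cases hR0 : R = 0
  · rw [hR0, card_norm_zero]; simp [add_comm]
  · rw [h.card_norm hRσ hR0]; simp [hR0]

theorem card_affineEq_of_ne (h : IsQuadraticConj q σ) {α β γ d e g : F} (hα : σ α = α)
    (hγ : σ γ = γ) (hg : σ g = g) (hα0 : α ≠ 0) :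
    ∃ Z, IsConicCard q Z ∧
      Nat.card {z : F × F // AffineEq σ α β γ d e g z.1 z.2} + q * Z = q ^ 3 + q ^ 2 := by
  refine ⟨_, ?_, h.card_affineEq_add_of_ne hα hγ hg hα0⟩
  obtain ⟨ε, hε, hε0⟩ := h.exists_anti
  let A : fixedBy σ := ⟨(1 - β) * σ (1 - β) - α * γ, by
    rw [mem_fixedBy]; simp only [map_mul, map_sub, map_one, h.conj_conj, hγ, hα]; ring⟩
  let B : fixedBy σ := ⟨(1 - β) * σ (ε + β * ε) + (ε + β * ε) * σ (1 - β), by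
    rw [mem_fixedBy]; simp only [map_mul, map_sub, map_add, map_one, h.conj_conj]; ring⟩
  let C : fixedBy σ := ⟨(ε + β * ε) * σ (ε + β * ε) - α * γ * (ε * σ ε), by
    rw [mem_fixedBy]; simp only [map_mul, map_sub, map_add, h.conj_conj, hγ, hα]; ring⟩
  let D : fixedBy σ := ⟨(1 - β) * σ d + d * σ (1 - β) + α * (e + σ e), by
    rw [mem_fixedBy]; simp only [map_mul, map_sub, map_add, map_one, h.conj_conj, hα]; ring⟩
  let E : fixedBy σ := ⟨(ε + β * ε) * σ d + d * σ (ε + β * ε) + α * (e * ε + σ (e * ε)), by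
    rw [mem_fixedBy]; simp only [map_mul, map_add, h.conj_conj, hα]; ring⟩
  let G : fixedBy σ := ⟨d * σ d + α * g, by
    rw [mem_fixedBy]; simp only [map_mul, map_add, h.conj_conj, hα, hg]; ring⟩
  have key := isConicCard_quadratic h.two_ne_fixed h.anisotropicCount A B C D E G
  rw [h.card_fixedBy] at key
  refine (congrArg _ ?_).mp key
  refine card_subtype_congr (h.coordEquiv hε hε0) fun z => ?_
  rw [Subtype.ext_iff, coordEquiv_apply]
  change ((1 - β) * σ (1 - β) - α * γ) * (z.1 : F) ^ 2 +
    ((1 - β) * σ (ε + β * ε) + (ε + β * ε) * σ (1 - β)) * z.1 * z.2 +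
    ((ε + β * ε) * σ (ε + β * ε) - α * γ * (ε * σ ε)) * (z.2 : F) ^ 2 +
    ((1 - β) * σ d + d * σ (1 - β) + α * (e + σ e)) * z.1 +
    ((ε + β * ε) * σ d + d * σ (ε + β * ε) + α * (e * ε + σ (e * ε))) * z.2 +
    (d * σ d + α * g) = 0 ↔ _
  simp only [map_mul, map_sub, map_add, map_one, map_neg, hε, mem_fixedBy.1 z.1.2,
    mem_fixedBy.1 z.2.2]
  constructor <;> intro h <;> linear_combination h

end IsQuadraticConj

end AffinePart

section Projective

theorem card_projectivization_rep {F V : Type*} [Field F] [AddCommGroup V] [Module F V]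
    (p : V → Prop) (hp : ∀ (t : Fˣ) v, p v → p (t • v)) :
    Nat.card {P : Projectivization F V // p P.rep} * Nat.card Fˣ = Nat.card {v // p v ∧ v ≠ 0} := by
  rw [← Nat.card_prod]
  refine Nat.card_eq_of_bijective
    (fun z => ⟨z.2 • z.1.1.rep, hp _ _ z.1.2, smul_ne_zero z.2.ne_zero z.1.1.rep_nonzero⟩)
    ⟨fun z w hzw => ?_, fun v => ?_⟩
  · have h1 : z.2 • z.1.1.rep = w.2 • w.1.1.rep := congrArg Subtype.val hzw
    have h2 : z.1.1 = w.1.1 := by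
      rw [← z.1.1.mk_rep, ← w.1.1.mk_rep, Projectivization.mk_eq_mk_iff]
      exact ⟨z.2⁻¹ * w.2, by rw [mul_smul, ← h1, inv_smul_smul]⟩
    refine Prod.ext (Subtype.ext h2) (Units.ext ?_)
    rw [h2] at h1
    exact smul_left_injective F w.1.1.rep_nonzero h1
  · obtain ⟨t, ht⟩ := Projectivization.exists_smul_eq_mk_rep F v.1 v.2.2
    refine ⟨(⟨Projectivization.mk F v.1 v.2.2, ht ▸ hp t _ v.2.1⟩, t⁻¹), Subtype.ext ?_⟩
    change t⁻¹ • (Projectivization.mk F v.1 v.2.2).rep = v.1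
    rw [← ht, inv_smul_smul]

variable {F : Type} [Field F] {q : ℕ} {σ : F →+* F}

namespace IsQuadraticConj

theorem hermPt_iff (h : IsQuadraticConj q σ) (v : Fin 4 → F) :
    hermPt q v ↔ σ (v 0) * v 3 + v 0 * σ (v 3) = v 1 * σ (v 1) + v 2 * σ (v 2) := by
  simp only [hermPt, h.apply_eq, pow_succ']

theorem hermPt_smul_iff (h : IsQuadraticConj q σ) {t : F} (ht : t ≠ 0) (v : Fin 4 → F) :
    hermPt q (t • v) ↔ hermPt q v := by
  have ht' : t * σ t ≠ 0 := mul_ne_zero ht (by simpa using ht)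
  simp only [h.hermPt_iff, Pi.smul_apply, smul_eq_mul, map_mul]
  constructor
  · intro h; apply mul_left_cancel₀ ht'; linear_combination h
  · intro h; linear_combination t * σ t * h

end IsQuadraticConj

theorem quadPt_smul_iff {a b c d e f t : F} (ht : t ≠ 0) (v : Fin 4 → F) :
    quadPt a b c d e f (t • v) ↔ quadPt a b c d e f v := by
  simp only [quadPt, Pi.smul_apply, smul_eq_mul]
  constructor
  · intro h; apply mul_left_cancel₀ (pow_ne_zero 2 ht); linear_combination h
  · intro h; linear_combination t ^ 2 * h

/-- A split binary quadratic form is `u * v` in suitable linear coordinates. -/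
theorem exists_split_coordinates (h2 : (2 : F) ≠ 0) {a b c δ : F} (hδ : δ ^ 2 = c ^ 2 - 4 * a * b)
    (hδ0 : δ ≠ 0) :
    ∃ L : F × F ≃ F × F, ∃ p₁ p₂ p₃ p₄ : F,
      (∀ z, L z = (p₁ * z.1 + p₂ * z.2, p₃ * z.1 + p₄ * z.2)) ∧
      ∀ z, a * (L z).1 ^ 2 + b * (L z).2 ^ 2 + c * (L z).1 * (L z).2 = z.1 * z.2 := by
  have build : ∀ p₁ p₂ p₃ p₄ : F, p₁ * p₄ - p₂ * p₃ ≠ 0 →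
      ∃ L : F × F ≃ F × F, ∀ z, L z = (p₁ * z.1 + p₂ * z.2, p₃ * z.1 + p₄ * z.2) := by
    intro p₁ p₂ p₃ p₄ hD
    refine ⟨⟨fun z => (p₁ * z.1 + p₂ * z.2, p₃ * z.1 + p₄ * z.2),
      fun z => ((p₄ * z.1 - p₂ * z.2) / (p₁ * p₄ - p₂ * p₃),
        (p₁ * z.2 - p₃ * z.1) / (p₁ * p₄ - p₂ * p₃)), fun z => ?_, fun z => ?_⟩, fun z => rfl⟩
    · refine Prod.ext ?_ ?_ <;> dsimp only <;> rw [div_eq_iff hD] <;> ring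
    · refine Prod.ext ?_ ?_ <;> dsimp only <;> rw [← mul_div_assoc, ← mul_div_assoc, ← add_div,
        div_eq_iff hD] <;> ring
  by_cases ha : a = 0
  · subst ha
    have hc : c ≠ 0 := by
      rintro rfl
      apply hδ0
      simpa using hδ
    obtain ⟨L, hL⟩ := build (-b / c) (1 / c) 1 0 (by simpa using hc)
    refine ⟨L, _, _, _, _, hL, fun z => ?_⟩
    rw [hL]
    field_simp
    ring
  · obtain ⟨L, hL⟩ := build ((δ + c) / (2 * δ)) ((δ - c) / (2 * a * δ)) (-a / δ) (1 / δ) (by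
      have : (δ + c) / (2 * δ) * (1 / δ) - (δ - c) / (2 * a * δ) * (-a / δ) = 1 / δ := by
        field_simp; ring
      rw [this]; exact one_div_ne_zero hδ0)
    refine ⟨L, _, _, _, _, hL, fun z => ?_⟩
    rw [hL]
    have hb : b = (c ^ 2 - δ ^ 2) / (4 * a) := by
      have h4 : (4 : F) ≠ 0 := by
        have : (4 : F) = 2 * 2 := by norm_num
        rw [this]; exact mul_ne_zero h2 h2
      rw [eq_div_iff (mul_ne_zero h4 ha)]; linear_combination hδ
    have h4 : (4 : F) = 2 * 2 := by norm_num
    rw [hb, h4]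
    field_simp
    ring

variable [Finite F]

/-- The number of points at infinity, in split coordinates, is governed by the vanishing of the
diagonal coefficients of the Hermitian form. -/
theorem card_infinity (α β γ : F) :
    ((α ≠ 0 ∧ γ ≠ 0 ∧ Nat.card {z : F × F // z.1 * z.2 = 0 ∧ α * (z.1 * σ z.1) +
        γ * (z.2 * σ z.2) + (β * (z.1 * σ z.2) + σ (β * (z.1 * σ z.2))) = 0} = 1) ∨
      ((α = 0 ∧ γ ≠ 0 ∨ α ≠ 0 ∧ γ = 0) ∧ Nat.card {z : F × F // z.1 * z.2 = 0 ∧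
        α * (z.1 * σ z.1) + γ * (z.2 * σ z.2) + (β * (z.1 * σ z.2) + σ (β * (z.1 * σ z.2))) = 0}
          = Nat.card F)) ∨
      (α = 0 ∧ γ = 0 ∧ Nat.card {z : F × F // z.1 * z.2 = 0 ∧ α * (z.1 * σ z.1) +
        γ * (z.2 * σ z.2) + (β * (z.1 * σ z.2) + σ (β * (z.1 * σ z.2))) = 0} + 1
          = 2 * Nat.card F) := by
  have key : ∀ z : F × F, (z.1 * z.2 = 0 ∧ α * (z.1 * σ z.1) +
        γ * (z.2 * σ z.2) + (β * (z.1 * σ z.2) + σ (β * (z.1 * σ z.2))) = 0) ↔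
      (z.1 = 0 ∧ (γ = 0 ∨ z.2 = 0)) ∨ (z.2 = 0 ∧ (α = 0 ∨ z.1 = 0)) := by
    rintro ⟨u, v⟩
    by_cases hu : u = 0 <;> by_cases hv : v = 0 <;> simp [hu, hv]
  rw [Nat.card_congr (Equiv.subtypeEquivRight key)]
  by_cases hα : α = 0 <;> by_cases hγ : γ = 0
  · right
    refine ⟨hα, hγ, ?_⟩
    rw [← card_hyperbola_zero]
    congr 1
    exact Nat.card_congr (Equiv.subtypeEquivRight fun z => by simp [hα, hγ])
  · left; right
    refine ⟨.inl ⟨hα, hγ⟩, ?_⟩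
    refine Nat.card_congr
      ⟨fun z => z.1.1, fun u => ⟨(u, 0), by simp [hα]⟩, fun z => ?_, fun u => rfl⟩
    have : z.1.2 = 0 := by have := z.2; tauto
    exact Subtype.ext (Prod.ext rfl this.symm)
  · left; right
    refine ⟨.inr ⟨hα, hγ⟩, ?_⟩
    refine Nat.card_congr
      ⟨fun z => z.1.2, fun u => ⟨(0, u), by simp [hγ]⟩, fun z => ?_, fun u => rfl⟩
    have : z.1.1 = 0 := by have := z.2; tauto
    exact Subtype.ext (Prod.ext this.symm rfl)
  · left; left
    refine ⟨hα, hγ, ?_⟩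
    rw [← card_subtype_eq ((0 : F), (0 : F))]
    refine Nat.card_congr (Equiv.subtypeEquivRight fun z => ?_)
    rw [Prod.ext_iff]
    simp only [hα, hγ, false_or]
    tauto

/-- Affine coordinates on `F ^ 4`. -/
def vecEquiv (F : Type*) : (((F × F) × F) × F) ≃ (Fin 4 → F) where
  toFun z := ![z.2, z.1.1.1, z.1.1.2, z.1.2]
  invFun v := (((v 1, v 2), v 3), v 0)
  left_inv _ := rfl
  right_inv v := by ext i; fin_cases i <;> rfl

namespace IsQuadraticConj

theorem exists_card_intersection (h : IsQuadraticConj q σ) {a b c d e f : F}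
    (hΔsq : IsSquare (4 * a * b - c ^ 2)) (hΔne : 4 * a * b - c ^ 2 ≠ 0) :
    ∃ α β γ d' e' g : F, σ α = α ∧ σ γ = γ ∧ σ g = g ∧
      Nat.card {P : Projectivization F (Fin 4 → F) //
        hermPt q P.rep ∧ quadPt a b c d e f P.rep} * (q ^ 2 - 1) + 1 =
      (q ^ 2 - 1) * Nat.card {z : F × F // AffineEq σ α β γ d' e' g z.1 z.2} +
      q ^ 2 * Nat.card {z : F × F // z.1 * z.2 = 0 ∧ α * (z.1 * σ z.1) +
        γ * (z.2 * σ z.2) + (β * (z.1 * σ z.2) + σ (β * (z.1 * σ z.2))) = 0} := by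
  classical
  have := Fintype.ofFinite F
  obtain ⟨i, hi⟩ := h.exists_sq_of_fixed (a := -1) (by simp)
  obtain ⟨s, hs⟩ := hΔsq
  have hi0 : i ≠ 0 := by rintro rfl; simp at hi
  have hs0 : s ≠ 0 := by rintro rfl; simp at hs; exact hΔne hs
  obtain ⟨L, p₁, p₂, p₃, p₄, hL, hφ⟩ := exists_split_coordinates (a := a) (b := b) (c := c)
    (δ := i * s) h.two_ne (by linear_combination (-(s ^ 2)) * hi + hs) (mul_ne_zero hi0 hs0)
  have herm : ∀ z : F × F, (L z).1 * σ (L z).1 + (L z).2 * σ (L z).2 =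
      (p₁ * σ p₁ + p₃ * σ p₃) * (z.1 * σ z.1) + (p₂ * σ p₂ + p₄ * σ p₄) * (z.2 * σ z.2) +
      ((p₁ * σ p₂ + p₃ * σ p₄) * (z.1 * σ z.2) +
        σ ((p₁ * σ p₂ + p₃ * σ p₄) * (z.1 * σ z.2))) := fun z => by
    rw [hL]
    simp only [map_mul, map_add, h.conj_conj]
    ring
  refine ⟨p₁ * σ p₁ + p₃ * σ p₃, p₁ * σ p₂ + p₃ * σ p₄, p₂ * σ p₂ + p₄ * σ p₄,
    d * p₁ + e * p₃, d * p₂ + e * p₄, f + σ f, ?_, ?_, ?_, ?_⟩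
  · simp only [map_mul, map_add, h.conj_conj]; ring
  · simp only [map_mul, map_add, h.conj_conj]; ring
  · simp only [map_add, h.conj_conj]; ring
  let p : (Fin 4 → F) → Prop := fun v => hermPt q v ∧ quadPt a b c d e f v
  have hp : ∀ t : F, t ≠ 0 → ∀ v, p (t • v) ↔ p v := fun t ht v =>
    and_congr (h.hermPt_smul_iff ht v) (quadPt_smul_iff ht v)
  have hp0 : p 0 := ⟨by rw [h.hermPt_iff]; simp, by simp [quadPt]⟩
  have hproj := card_projectivization_rep (F := F) p fun t v hv => (hp t t.ne_zero v).2 hv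
  rw [Nat.card_units, h.card_eq] at hproj
  have hzero : Nat.card {v // p v ∧ v ≠ 0} + 1 = Nat.card {v // p v} := by
    have h1 : Nat.card {v // p v ∧ v ≠ 0} + Nat.card {v // p v ∧ ¬ v ≠ 0} =
        Nat.card {v // p v} := by
      simp only [card_subtype_eq_sum, ← Finset.sum_add_distrib]
      refine Finset.sum_congr rfl fun v _ => ?_
      by_cases hv : v = 0 <;> simp [hv]
    rw [← h1, ← card_subtype_eq (0 : Fin 4 → F)]
    congr 1
    exact Nat.card_congr (Equiv.subtypeEquivRight fun v =>
      ⟨fun hv => ⟨hv ▸ hp0, by simpa using hv⟩, fun hv => by simpa using hv.2⟩)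
  have hinf : Nat.card {w : (F × F) × F // p (vecEquiv F (w, 0))} =
      q ^ 2 * Nat.card {z : F × F // z.1 * z.2 = 0 ∧
        (p₁ * σ p₁ + p₃ * σ p₃) * (z.1 * σ z.1) + (p₂ * σ p₂ + p₄ * σ p₄) * (z.2 * σ z.2) +
        ((p₁ * σ p₂ + p₃ * σ p₄) * (z.1 * σ z.2) +
        σ ((p₁ * σ p₂ + p₃ * σ p₄) * (z.1 * σ z.2))) = 0} := by
    rw [← h.card_eq, mul_comm, ← Nat.card_prod,
      ← Nat.card_congr (Equiv.prodSubtypeFstEquivSubtypeProd (α := F × F) (β := F))]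
    symm
    refine card_subtype_congr (L.prodCongr (Equiv.refl F)) fun w => ?_
    have h0 : vecEquiv F ((L.prodCongr (Equiv.refl F)) w, 0) =
        ![0, (L w.1).1, (L w.1).2, w.2] := rfl
    simp only [p, h.hermPt_iff, quadPt, ← herm, ← hφ, h0, Matrix.cons_val_zero,
      Matrix.cons_val_one, Matrix.cons_val, map_zero, zero_mul, mul_zero, add_zero,
      zero_pow two_ne_zero]
    rw [and_comm, eq_comm, @eq_comm _ (_ + _) (0 : F)]
  have haff1 : Nat.card {w : (F × F) × F // p (vecEquiv F (w, 1))} =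
      Nat.card {z : F × F // AffineEq σ (p₁ * σ p₁ + p₃ * σ p₃) (p₁ * σ p₂ + p₃ * σ p₄)
        (p₂ * σ p₂ + p₄ * σ p₄) (d * p₁ + e * p₃) (d * p₂ + e * p₄) (f + σ f) z.1 z.2} := by
    have hpt : ∀ (z : F × F) (t : F), p (vecEquiv F ((L z, t), 1)) ↔
        t + σ t = (L z).1 * σ (L z).1 + (L z).2 * σ (L z).2 ∧
          t = z.1 * z.2 + (d * p₁ + e * p₃) * z.1 + (d * p₂ + e * p₄) * z.2 + f := fun z t => by
      have h0 : vecEquiv F ((L z, t), 1) = ![1, (L z).1, (L z).2, t] := rfl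
      simp only [p, h.hermPt_iff, quadPt, h0, Matrix.cons_val_zero,
        Matrix.cons_val_one, Matrix.cons_val, map_one, one_mul, mul_one, one_pow, hφ]
      rw [hL]
      refine and_congr Iff.rfl ?_
      constructor <;> intro h <;> linear_combination h
    have hz : ∀ z : F × F, AffineEq σ (p₁ * σ p₁ + p₃ * σ p₃) (p₁ * σ p₂ + p₃ * σ p₄)
        (p₂ * σ p₂ + p₄ * σ p₄) (d * p₁ + e * p₃) (d * p₂ + e * p₄) (f + σ f) z.1 z.2 ↔
        p (vecEquiv F ((L z, z.1 * z.2 + (d * p₁ + e * p₃) * z.1 + (d * p₂ + e * p₄) * z.2 + f),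
          1)) := fun z => by
      rw [hpt, herm, AffineEq, and_iff_left rfl, map_add σ _ f]
      constructor <;> intro h <;> linear_combination h
    have hw : ∀ w : {w : (F × F) × F // p (vecEquiv F (w, 1))}, w.1 = (L (L.symm w.1.1),
        (L.symm w.1.1).1 * (L.symm w.1.1).2 + (d * p₁ + e * p₃) * (L.symm w.1.1).1 +
          (d * p₂ + e * p₄) * (L.symm w.1.1).2 + f) := fun w => by
      refine Prod.ext (L.apply_symm_apply _).symm ((hpt (L.symm w.1.1) w.1.2).1 ?_).2
      rw [L.apply_symm_apply]
      exact w.2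
    exact Nat.card_congr
      { toFun := fun w => ⟨L.symm w.1.1, (hz _).2 (hw w ▸ w.2)⟩
        invFun := fun z => ⟨(L z.1, _), (hz z.1).1 z.2⟩
        left_inv := fun w => Subtype.ext (hw w).symm
        right_inv := fun z => Subtype.ext (L.symm_apply_apply _) }
  have haff : ∀ j : F, j ≠ 0 → Nat.card {w : (F × F) × F // p (vecEquiv F (w, j))} =
      Nat.card {w : (F × F) × F // p (vecEquiv F (w, 1))} := fun j hj => by
    symm
    refine card_subtype_congr
      (((Equiv.mulLeft₀ j hj).prodCongr (Equiv.mulLeft₀ j hj)).prodCongr (Equiv.mulLeft₀ j hj))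
      fun w => ?_
    rw [← hp j hj]
    apply iff_of_eq
    congr 1
    ext i
    fin_cases i
    · exact mul_one j
    all_goals rfl
  have hsum : Nat.card {v // p v} = ∑ j, Nat.card {w : (F × F) × F // p (vecEquiv F (w, j))} := by
    rw [← card_subtype_prod fun w j => p (vecEquiv F (w, j))]
    exact (card_subtype_congr (vecEquiv F) fun w => Iff.rfl).symm
  rw [hproj, hzero, hsum, ← hinf, ← haff1, ← Finset.sum_erase_add _ _ (Finset.mem_univ (0 : F)),
    Finset.sum_congr rfl fun j hj => haff j (Finset.ne_of_mem_erase hj), Finset.sum_const,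
    Finset.card_erase_of_mem (Finset.mem_univ _), Finset.card_univ, ← Nat.card_eq_fintype_card,
    h.card_eq, smul_eq_mul]

end IsQuadraticConj

end Projective

section Arithmetic

theorem card_eq_of_projective_count {q N A M k : ℕ} (hq : 2 ≤ q)
    (hN : N * (q ^ 2 - 1) + 1 = (q ^ 2 - 1) * A + q ^ 2 * M) (hM : M + k = 1 + k * q ^ 2) :
    N = A + 1 + k * q ^ 2 := by
  have h4 : 2 ^ 2 ≤ q ^ 2 := Nat.pow_le_pow_left hq 2
  obtain ⟨m, hm⟩ : ∃ m, q ^ 2 = m + 1 := ⟨q ^ 2 - 1, by omega⟩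
  rw [hm] at hN hM h4 ⊢
  rw [Nat.add_sub_cancel] at hN
  obtain rfl : M = 1 + k * m := by linarith
  exact Nat.eq_of_mul_eq_mul_right (by omega : 0 < m) (by linarith)

theorem IsConicCard.values {q Z A : ℕ} (hq : 2 ≤ q) (hZ : IsConicCard q Z)
    (hA : A + q * Z = q ^ 3 + q ^ 2) :
    A = q ^ 3 + q ^ 2 ∨ A + q = q ^ 3 + q ^ 2 ∨ A = q ^ 3 + q ∨ A = q ^ 3 ∨ A + q = q ^ 3 ∨
      A + q ^ 2 = q ^ 3 + q ∨ A + q ^ 2 = q ^ 3 ∨ A = q ^ 2 := by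
  rcases hZ with h | h | h | h | h | h | h | h
  · subst h; omega
  · subst h; omega
  · have : q * Z + q = q ^ 2 := by rw [sq, ← Nat.mul_succ, Nat.succ_eq_add_one, h]
    omega
  · have : q * Z = q ^ 2 := by rw [sq, h]
    omega
  · have : q * Z = q ^ 2 + q := by rw [h]; ring
    omega
  · have : q * Z + q = 2 * q ^ 2 := by rw [← Nat.mul_succ, Nat.succ_eq_add_one, h]; ring
    omega
  · have : q * Z = 2 * q ^ 2 := by rw [h]; ring
    omega
  · have : q * Z = q ^ 3 := by rw [h]; ring
    omega

end Arithmetic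

theorem hyperbolic_intersection_sizes
    (q : ℕ) (hq : ∃ p n : ℕ, p.Prime ∧ Odd p ∧ 0 < n ∧ q = p ^ n)
    (F : Type) [Field F] [Fintype F] (hF : Fintype.card F = q ^ 2)
    (a b c d e f : F)
    (hΔsq : IsSquare (4 * a * b - c ^ 2)) (hΔne : 4 * a * b - c ^ 2 ≠ 0) :
    Nat.card {P : Projectivization F (Fin 4 → F) //
        hermPt q P.rep ∧ quadPt a b c d e f P.rep} ∈
      ({q ^ 2 + 1, q ^ 3 - q ^ 2 + 1, q ^ 3 - q ^ 2 + q + 1, q ^ 3 - q + 1,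
        q ^ 3 + 1, q ^ 3 + q + 1, q ^ 3 + q ^ 2 - q + 1, q ^ 3 + q ^ 2 + 1,
        q ^ 3 + 2 * q ^ 2 - q + 1, q ^ 3 + 2 * q ^ 2 + 1,
        q ^ 3 + 3 * q ^ 2 - q + 1, 2 * q ^ 3 + q ^ 2 + 1} : Set ℕ) := by
  obtain ⟨p, n, hp, hodd, hn, rfl⟩ := hq
  have := Fact.mk hp
  have hchar : CharP F p := charP_of_card_eq_prime_pow (f := n * 2) (by rw [hF, pow_mul])
  have h : IsQuadraticConj (p ^ n) (iterateFrobenius F p n) :=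
    { apply_eq := fun x => iterateFrobenius_def p n x
      card_eq := by rw [Nat.card_eq_fintype_card, hF]
      two_ne := fun h2 => by
        have h3 : ((2 : ℕ) : F) = 0 := by exact_mod_cast h2
        rw [CharP.cast_eq_zero_iff F p, Nat.prime_dvd_prime_iff_eq hp Nat.prime_two] at h3
        subst h3
        exact absurd hodd (by decide) }
  generalize iterateFrobenius F p n = σ at h
  generalize p ^ n = q at *
  obtain ⟨α, β, γ, d', e', g, hα, hγ, hg, hN⟩ :=
    h.exists_card_intersection (d := d) (e := e) (f := f) hΔsq hΔne
  have h2 := h.two_le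
  have hinf := card_infinity (σ := σ) α β γ
  rw [h.card_eq] at hinf
  have hz1 : α ≠ 0 → _ := fun hα0 =>
    h.card_affineEq_of_ne (β := β) (d := d') (e := e') hα hγ hg hα0
  have hz2 : α = 0 → _ := fun h0 =>
    h.card_affineEq_of_zero (β := β) (d := d') (e := e') hγ hg
      (N := Nat.card {z : F × F // AffineEq σ α β γ d' e' g z.1 z.2}) (by rw [h0])
  have hz3 : γ = 0 → _ := fun h0 =>
    h.card_affineEq_of_zero (β := σ β) (d := e') (e := d') hα hg
      (N := Nat.card {z : F × F // AffineEq σ α β γ d' e' g z.1 z.2})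
      (by rw [h.card_affineEq_swap, h0])
  generalize Nat.card {z : F × F // AffineEq σ α β γ d' e' g z.1 z.2} = A at *
  generalize Nat.card {P : Projectivization F (Fin 4 → F) //
    hermPt q P.rep ∧ quadPt a b c d e f P.rep} = N at *
  have hq2 : 2 * q ≤ q ^ 2 := by nlinarith
  have hq3 : 2 * q ^ 2 ≤ q ^ 3 := by nlinarith
  rcases hinf with (⟨hα0, -, hM⟩ | ⟨hαγ, hM⟩) | ⟨hα0, hγ0, hM⟩
  · obtain ⟨Z, hZ, hA⟩ := hz1 hα0
    have hA := hZ.values h2 hA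
    have hN := card_eq_of_projective_count (k := 0) h2 hN (by rw [hM]; ring)
    rcases hA with hA | hA | hA | hA | hA | hA | hA | hA
    · rw [show N = q ^ 3 + q ^ 2 + 1 by omega]; simp
    · rw [show N = q ^ 3 + q ^ 2 - q + 1 by omega]; simp
    · rw [show N = q ^ 3 + q + 1 by omega]; simp
    · rw [show N = q ^ 3 + 1 by omega]; simp
    · rw [show N = q ^ 3 - q + 1 by omega]; simp
    · rw [show N = q ^ 3 - q ^ 2 + q + 1 by omega]; simp
    · rw [show N = q ^ 3 - q ^ 2 + 1 by omega]; simp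
    · rw [show N = q ^ 2 + 1 by omega]; simp
  · have hN := card_eq_of_projective_count (k := 1) h2 hN (by rw [hM]; ring)
    have hA : A = q ^ 3 ∨ A + q = q ^ 3 ∨ A + q = q ^ 3 + q ^ 2 ∨ A + q ^ 2 = q ^ 3 ∨
        A = q ^ 3 + q ^ 2 := by
      rcases hαγ with ⟨h0, h1⟩ | ⟨h1, h0⟩
      · rcases hz2 h0 with h' | h' | h' | h' | ⟨-, h'⟩ | ⟨hc, -⟩
        exacts [.inl h', .inr (.inl h'), .inr (.inr (.inl h')), .inr (.inr (.inr (.inl h'))),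
          .inr (.inr (.inr (.inr h'))), absurd hc h1]
      · rcases hz3 h0 with h' | h' | h' | h' | ⟨-, h'⟩ | ⟨hc, -⟩
        exacts [.inl h', .inr (.inl h'), .inr (.inr (.inl h')), .inr (.inr (.inr (.inl h'))),
          .inr (.inr (.inr (.inr h'))), absurd hc h1]
    rcases hA with hA | hA | hA | hA | hA
    · rw [show N = q ^ 3 + q ^ 2 + 1 by omega]; simp
    · rw [show N = q ^ 3 + q ^ 2 - q + 1 by omega]; simp
    · rw [show N = q ^ 3 + 2 * q ^ 2 - q + 1 by omega]; simp
    · rw [show N = q ^ 3 + 1 by omega]; simp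
    · rw [show N = q ^ 3 + 2 * q ^ 2 + 1 by omega]; simp
  · have hN := card_eq_of_projective_count (k := 2) h2 hN (by omega)
    have hA : A = q ^ 3 ∨ A + q = q ^ 3 ∨ A + q = q ^ 3 + q ^ 2 ∨ A + q ^ 2 = q ^ 3 ∨
        A + q ^ 2 = 2 * q ^ 3 := by
      rcases hz2 hα0 with h' | h' | h' | h' | ⟨hc, -⟩ | ⟨-, h'⟩
      exacts [.inl h', .inr (.inl h'), .inr (.inr (.inl h')), .inr (.inr (.inr (.inl h'))),
        absurd hγ0 hc, .inr (.inr (.inr (.inr h')))]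
    rcases hA with hA | hA | hA | hA | hA
    · rw [show N = q ^ 3 + 2 * q ^ 2 + 1 by omega]; simp
    · rw [show N = q ^ 3 + 2 * q ^ 2 - q + 1 by omega]; simp
    · rw [show N = q ^ 3 + 3 * q ^ 2 - q + 1 by omega]; simp
    · rw [show N = q ^ 3 + q ^ 2 + 1 by omega]; simp
    · rw [show N = 2 * q ^ 3 + q ^ 2 + 1 by omega]; simp
end

section
/- Suppose Δ = 4ab − c² = 0 and (a,b,c) ≠ (0,0,0) (so Q is a quadric cone). Then the set C∞ = H ∩ Q ∩ {j = 0} of common points at infinity has exactly q²+1 points (the points of a line) if c ≠ 0 and c^(q+1) + 4a^(q+1) = 0, and exactly one point (namely P = [0:0:0:1]) otherwise. -/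
/-- The points of `ℙ k V` lying on the image of an injective linear map `W → V` are counted
by `ℙ k W`. -/
theorem card_projectivization_rep_mem_range {k V W : Type*} [Field k] [AddCommGroup V]
    [Module k V] [AddCommGroup W] [Module k W] (L : W →ₗ[k] V) (hL : Function.Injective L) :
    Nat.card {P : Projectivization k V // P.rep ∈ LinearMap.range L} =
      Nat.card (Projectivization k W) := by
  have hrange : Set.range (Projectivization.map L hL) =
      {P : Projectivization k V | P.rep ∈ LinearMap.range L} := by
    ext P
    constructor
    · rintro ⟨R, rfl⟩
      induction R using Projectivization.ind with
      | h v hv =>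
        rw [Projectivization.map_mk]
        obtain ⟨u, hu⟩ := Projectivization.exists_smul_eq_mk_rep k (L v)
          (fun h => hv (hL (h.trans (map_zero L).symm)))
        exact ⟨(u : k) • v, by rw [map_smul]; exact hu⟩
    · rintro ⟨w, hw⟩
      have hw0 : w ≠ 0 := fun h => P.rep_nonzero (by rw [← hw, h, map_zero])
      refine ⟨Projectivization.mk k w hw0, ?_⟩
      rw [Projectivization.map_mk]
      conv_rhs => rw [← P.mk_rep]
      congr 1
  have hcard := Nat.card_range_of_injective
    (Projectivization.map_injective (τ := RingHom.id k) L hL)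
  rw [hrange] at hcard
  exact hcard

/-- In a finite field of odd order `q²`, the element `2` is nonzero and fixed by `x ↦ x ^ q`. -/
theorem two_ne_zero_and_two_pow_eq {q : ℕ}
    (hq : ∃ p n : ℕ, p.Prime ∧ Odd p ∧ 0 < n ∧ q = p ^ n)
    {F : Type*} [Field F] [Fintype F] (hF : Fintype.card F = q ^ 2) :
    (2 : F) ≠ 0 ∧ (2 : F) ^ q = 2 := by
  obtain ⟨p, n, hp, hodd, -, rfl⟩ := hq
  have := Fact.mk hp
  have : CharP F p := charP_of_card_eq_prime_pow (hF.trans (pow_mul p n 2).symm)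
  refine ⟨fun h => ?_, ?_⟩
  · have h2 : p ∣ 2 := (CharP.cast_eq_zero_iff F p 2).mp (by exact_mod_cast h)
    rw [(Nat.prime_dvd_prime_iff_eq hp Nat.prime_two).mp h2] at hodd
    exact absurd hodd (by decide)
  · rw [← iterateFrobenius_def, map_ofNat]

/-- A nonzero binary quadratic form of discriminant zero with `a ≠ 0` vanishes exactly on the
line `x = -c / (2a) * y`. -/
theorem binary_quadratic_eq_zero_iff {F : Type*} [Field F] {a b c : F} (h2 : (2 : F) ≠ 0)
    (ha : a ≠ 0) (hΔ : 4 * a * b - c ^ 2 = 0) (x y : F) :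
    a * x ^ 2 + b * y ^ 2 + c * x * y = 0 ↔ x = -c / (2 * a) * y := by
  have h4a : 2 * 2 * a ≠ 0 := mul_ne_zero (mul_ne_zero h2 h2) ha
  have hsq : 2 * 2 * a * (a * x ^ 2 + b * y ^ 2 + c * x * y) = (2 * a * x + c * y) ^ 2 := by
    linear_combination y ^ 2 * hΔ
  rw [← mul_eq_zero_iff_left h4a, hsq, sq_eq_zero_iff, div_mul_eq_mul_div,
    eq_div_iff (mul_ne_zero h2 ha)]
  constructor <;> intro h <;> linear_combination h

theorem neg_div_two_mul_pow_eq_neg_one_iff {F : Type*} [Field F] {a c : F} {q : ℕ}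
    (h2 : (2 : F) ≠ 0) (h2q : (2 : F) ^ q = 2) (hodd : Odd q) (ha : a ≠ 0) :
    (-c / (2 * a)) ^ (q + 1) = -1 ↔ c ^ (q + 1) + 4 * a ^ (q + 1) = 0 := by
  have h4 : (2 : F) ^ (q + 1) = 4 := by rw [pow_succ, h2q]; norm_num
  rw [div_pow, hodd.add_one.neg_pow, div_eq_iff (pow_ne_zero _ (mul_ne_zero h2 ha)), mul_pow, h4]
  constructor <;> intro h <;> linear_combination h

/-- On the plane `j = 0`, the equations of `H` and `Q` only involve the coordinates `x` and `y`. -/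
theorem mem_plane_at_infinity_iff {F : Type} [Field F] {q : ℕ} (hq : q ≠ 0)
    (a b c d e f : F) (v : Fin 4 → F) :
    (v 0 = 0 ∧ hermPt q v ∧ quadPt a b c d e f v) ↔
      v 0 = 0 ∧ (v 1) ^ (q + 1) + (v 2) ^ (q + 1) = 0 ∧
        a * (v 1) ^ 2 + b * (v 2) ^ 2 + c * (v 1) * (v 2) = 0 := by
  refine and_congr_right fun h0 => ?_
  simp [hermPt, quadPt, h0, hq, eq_comm (a := (0 : F))]

/-- The linear map parametrising the line `j = 0`, `x = t * y`. -/
def lineAtInfinity {F : Type*} [Field F] (t : F) : (Fin 2 → F) →ₗ[F] (Fin 4 → F) where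
  toFun w := ![0, t * w 0, w 0, w 1]
  map_add' v w := by ext i; fin_cases i <;> simp [mul_add]
  map_smul' r w := by ext i; fin_cases i <;> simp [mul_left_comm]

theorem lineAtInfinity_injective {F : Type*} [Field F] (t : F) :
    Function.Injective (lineAtInfinity t) := by
  intro v w h
  ext i
  fin_cases i
  · exact congrFun h 2
  · exact congrFun h 3

theorem mem_range_lineAtInfinity_iff {F : Type*} [Field F] (t : F) (v : Fin 4 → F) :
    v ∈ LinearMap.range (lineAtInfinity t) ↔ v 0 = 0 ∧ v 1 = t * v 2 := by
  constructor
  · rintro ⟨w, rfl⟩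
    exact ⟨rfl, rfl⟩
  · rintro ⟨h0, h1⟩
    refine ⟨![v 2, v 3], ?_⟩
    ext i
    fin_cases i <;> simp [lineAtInfinity, h0, h1]

theorem mem_range_single_three_iff {F : Type*} [Field F] (v : Fin 4 → F) :
    v ∈ LinearMap.range (LinearMap.single F (fun _ : Fin 4 => F) 3) ↔
      v 0 = 0 ∧ v 1 = 0 ∧ v 2 = 0 := by
  constructor
  · rintro ⟨w, rfl⟩
    simp
  · rintro ⟨h0, h1, h2⟩
    refine ⟨v 3, ?_⟩
    ext i
    fin_cases i <;> simp [h0, h1, h2]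

theorem cone_points_at_infinity
    (q : ℕ) (hq : ∃ p n : ℕ, p.Prime ∧ Odd p ∧ 0 < n ∧ q = p ^ n)
    (F : Type) [Field F] [Fintype F] (hF : Fintype.card F = q ^ 2)
    (a b c d e f : F)
    (hΔ : 4 * a * b - c ^ 2 = 0) (habc : ¬ (a = 0 ∧ b = 0 ∧ c = 0)) :
    (c ≠ 0 ∧ c ^ (q + 1) + 4 * a ^ (q + 1) = 0 →
      Nat.card {P : Projectivization F (Fin 4 → F) //
          P.rep 0 = 0 ∧ hermPt q P.rep ∧ quadPt a b c d e f P.rep} = q ^ 2 + 1) ∧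
    (¬ (c ≠ 0 ∧ c ^ (q + 1) + 4 * a ^ (q + 1) = 0) →
      Nat.card {P : Projectivization F (Fin 4 → F) //
          P.rep 0 = 0 ∧ hermPt q P.rep ∧ quadPt a b c d e f P.rep} = 1) := by
  obtain ⟨h2, h2q⟩ := two_ne_zero_and_two_pow_eq hq hF
  have hodd : Odd q := by
    obtain ⟨p, n, -, hp, -, rfl⟩ := hq
    exact hp.pow
  have hq0 : q ≠ 0 := hodd.pos.ne'
  simp_rw [mem_plane_at_infinity_iff hq0]
  constructor
  · rintro ⟨hc, hac⟩
    have ha : a ≠ 0 := by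
      rintro rfl
      simp [hc] at hac
    have ht := (neg_div_two_mul_pow_eq_neg_one_iff h2 h2q hodd ha).mpr hac
    have hmem (v : Fin 4 → F) :
        (v 0 = 0 ∧ (v 1) ^ (q + 1) + (v 2) ^ (q + 1) = 0 ∧
          a * (v 1) ^ 2 + b * (v 2) ^ 2 + c * (v 1) * (v 2) = 0) ↔
        v ∈ LinearMap.range (lineAtInfinity (-c / (2 * a))) := by
      rw [binary_quadratic_eq_zero_iff h2 ha hΔ, mem_range_lineAtInfinity_iff]
      refine and_congr_right fun _ => and_iff_right_of_imp fun h => ?_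
      rw [h, mul_pow, ht]
      ring
    simp_rw [hmem]
    rw [card_projectivization_rep_mem_range _ (lineAtInfinity_injective _),
      Projectivization.card_of_finrank_two F _ (by simp), Nat.card_eq_fintype_card, hF]
  · intro hac
    have hmem (v : Fin 4 → F) :
        (v 0 = 0 ∧ (v 1) ^ (q + 1) + (v 2) ^ (q + 1) = 0 ∧
          a * (v 1) ^ 2 + b * (v 2) ^ 2 + c * (v 1) * (v 2) = 0) ↔
        v ∈ LinearMap.range (LinearMap.single F (fun _ : Fin 4 => F) 3) := by
      rw [mem_range_single_three_iff]
      refine and_congr_right fun _ => ⟨?_, fun ⟨h1, h2⟩ => by simp [h1, h2]⟩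
      rintro ⟨hH, hQ⟩
      by_cases ha : a = 0
      · have hc : c = 0 := by simpa [ha] using hΔ
        have hb : b ≠ 0 := fun hb => habc ⟨ha, hb, hc⟩
        have hv2 : v 2 = 0 := by simpa [ha, hc, hb] using hQ
        exact ⟨by simpa [hv2] using hH, hv2⟩
      · rw [binary_quadratic_eq_zero_iff h2 ha hΔ] at hQ
        have ht : (-c / (2 * a)) ^ (q + 1) ≠ -1 := by
          rw [Ne, neg_div_two_mul_pow_eq_neg_one_iff h2 h2q hodd ha]
          refine fun h => hac ⟨?_, h⟩
          rintro rfl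
          have h4 : (4 : F) ≠ 0 := by
            convert mul_ne_zero h2 h2 using 1
            norm_num
          simp [ha, h4] at h
        have hv2 : v 2 = 0 := by
          rw [hQ, mul_pow, ← add_one_mul] at hH
          exact eq_zero_of_pow_eq_zero
            ((mul_eq_zero.mp hH).resolve_left fun h => ht (eq_neg_of_add_eq_zero_left h))
        exact ⟨by rw [hQ, hv2, mul_zero], hv2⟩
    simp_rw [hmem]
    rw [card_projectivization_rep_mem_range _ (LinearMap.ker_eq_bot.mp (LinearMap.ker_single _ _ _)),
      Projectivization.card_of_finrank F _ (Module.finrank_self F)]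
    simp
end

section
/- Suppose Δ = 4ab − c² is a nonzero square in F (so Q is a hyperbolic quadric). Then the set C∞ = H ∩ Q ∩ {j = 0} of common points at infinity has exactly 1, q²+1 or 2q²+1 points. -/
/-- The points at infinity whose middle coordinates satisfy a homogeneous relation `R` form a cone
over the projective zeros of `R`; here those zeros are among two distinct points. -/
lemma card_cone_at_infinity {F : Type} [Field F] [Fintype F] (R : F → F → Prop)
    (hR0 : R 0 0) (hR : ∀ t x y, t ≠ 0 → (R (t * x) (t * y) ↔ R x y))
    (X Y : Bool → F) (hXY : X true * Y false - X false * Y true ≠ 0)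
    (hsub : ∀ x y, R x y → ∃ i t, x = t * X i ∧ y = t * Y i) :
    Nat.card {P : Projectivization F (Fin 4 → F) // P.rep 0 = 0 ∧ R (P.rep 1) (P.rep 2)} =
      Nat.card {i // R (X i) (Y i)} * Fintype.card F + 1 := by
  have hmk : ∀ (v : Fin 4 → F) (hv : v ≠ 0),
      ((Projectivization.mk F v hv).rep 0 = 0 ∧
        R ((Projectivization.mk F v hv).rep 1) ((Projectivization.mk F v hv).rep 2)) ↔
      (v 0 = 0 ∧ R (v 1) (v 2)) := by
    intro v hv
    obtain ⟨t, ht⟩ := Projectivization.exists_smul_eq_mk_rep F v hv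
    rw [← ht]
    simp only [Pi.smul_apply, Units.smul_def, smul_eq_mul, mul_eq_zero, t.ne_zero, false_or]
    rw [hR _ _ _ t.ne_zero]
  have hne : ∀ i, ¬ (X i = 0 ∧ Y i = 0) := by
    rintro (_ | _) ⟨h1, h2⟩ <;> simp [h1, h2] at hXY
  have hv0 : (![0, 0, 0, 1] : Fin 4 → F) ≠ 0 := fun h => by simpa using congrFun h 3
  have hv1 : ∀ i z, (![0, X i, Y i, z] : Fin 4 → F) ≠ 0 := fun i z h =>
    hne i ⟨by simpa using congrFun h 1, by simpa using congrFun h 2⟩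
  let g : Option ({i // R (X i) (Y i)} × F) →
      {P : Projectivization F (Fin 4 → F) // P.rep 0 = 0 ∧ R (P.rep 1) (P.rep 2)} := fun o =>
    match o with
    | none => ⟨Projectivization.mk F _ hv0, (hmk _ _).2 ⟨rfl, hR0⟩⟩
    | some (i, z) => ⟨Projectivization.mk F _ (hv1 i z), (hmk _ _).2 ⟨rfl, i.2⟩⟩
  have hg : Function.Bijective g := by
    constructor
    · rintro (_ | ⟨⟨i, hi⟩, z⟩) (_ | ⟨⟨j, hj⟩, w⟩) h
      · rfl
      · obtain ⟨t, ht⟩ := (Projectivization.mk_eq_mk_iff' F _ _ _ _).1 (congrArg Subtype.val h)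
        have h1 := congrFun ht 1
        have h2 := congrFun ht 2
        have h3 := congrFun ht 3
        have := hne j
        simp at h1 h2 h3
        grind
      · obtain ⟨t, ht⟩ := (Projectivization.mk_eq_mk_iff' F _ _ _ _).1 (congrArg Subtype.val h)
        have h1 := congrFun ht 1
        have h2 := congrFun ht 2
        have := hne i
        simp at h1 h2
        grind
      · obtain ⟨t, ht⟩ := (Projectivization.mk_eq_mk_iff' F _ _ _ _).1 (congrArg Subtype.val h)
        have h1 : t * X j = X i := by simpa using congrFun ht 1
        have h2 : t * Y j = Y i := by simpa using congrFun ht 2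
        have h3 : t * w = z := by simpa using congrFun ht 3
        have hij : i = j := by
          cases i <;> cases j <;> first | rfl | (exfalso; apply hXY; rw [← h1, ← h2]; ring)
        subst hij
        have ht1 : t = 1 := by
          by_contra hc
          have hc' : t - 1 ≠ 0 := sub_ne_zero.2 hc
          exact hne i ⟨(mul_eq_zero.1 (by linear_combination h1 : (t - 1) * X i = 0)).resolve_left hc',
            (mul_eq_zero.1 (by linear_combination h2 : (t - 1) * Y i = 0)).resolve_left hc'⟩
        have hwz : z = w := by rw [← h3, ht1, one_mul]
        rw [hwz]
    · rintro ⟨P, hP⟩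
      induction P using Projectivization.ind with
      | h v hv =>
      obtain ⟨hv0', hRv⟩ := (hmk v hv).1 hP
      obtain ⟨i, t, hx, hy⟩ := hsub _ _ hRv
      by_cases ht : t = 0
      · refine ⟨none, Subtype.ext ?_⟩
        refine (Projectivization.mk_eq_mk_iff' F _ _ _ _).2 ⟨(v 3)⁻¹, ?_⟩
        have h3 : v 3 ≠ 0 := by
          intro h3
          apply hv
          ext k
          fin_cases k <;> simp [hv0', hx, hy, ht, h3]
        ext k
        fin_cases k <;> simp [hv0', hx, hy, ht, h3]
      · have hi : R (X i) (Y i) := by rwa [hx, hy, hR _ _ _ ht] at hRv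
        refine ⟨some (⟨i, hi⟩, t⁻¹ * v 3), Subtype.ext ?_⟩
        refine (Projectivization.mk_eq_mk_iff' F _ _ _ _).2 ⟨t⁻¹, ?_⟩
        ext k
        fin_cases k <;> simp [hv0', hx, hy, ht]
  rw [← Nat.card_congr (Equiv.ofBijective g hg), Finite.card_option, Nat.card_prod,
    Nat.card_eq_fintype_card (α := F)]

/-- A binary quadratic form whose discriminant is a nonzero square splits into two independent
linear factors. -/
lemma exists_linear_factors {F : Type} [Field F] (h2 : (2 : F) ≠ 0) (a b c s : F)
    (hs : c ^ 2 - 4 * a * b = s * s) (hs0 : s ≠ 0) :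
    ∃ α β γ δ : F, α * δ - β * γ ≠ 0 ∧
      ∀ x y, a * x ^ 2 + b * y ^ 2 + c * x * y = (α * x + β * y) * (γ * x + δ * y) := by
  by_cases ha : a = 0
  · subst ha
    refine ⟨0, 1, c, b, ?_, fun x y => by ring⟩
    have hc : c ≠ 0 := by
      rintro rfl
      apply hs0
      simpa using hs.symm
    simpa using hc
  · refine ⟨a, (c + s) / 2, 1, (c - s) / (2 * a), ?_, fun x y => ?_⟩
    · have : a * ((c - s) / (2 * a)) - (c + s) / 2 * 1 = -s := by field_simp; ring
      rw [this]
      exact neg_ne_zero.2 hs0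
    · field_simp
      linear_combination y ^ 2 * hs * (-1)

theorem hyperbolic_points_at_infinity
    (q : ℕ) (hq : ∃ p n : ℕ, p.Prime ∧ Odd p ∧ 0 < n ∧ q = p ^ n)
    (F : Type) [Field F] [Fintype F] (hF : Fintype.card F = q ^ 2)
    (a b c d e f : F)
    (hΔsq : IsSquare (4 * a * b - c ^ 2)) (hΔne : 4 * a * b - c ^ 2 ≠ 0) :
    Nat.card {P : Projectivization F (Fin 4 → F) //
        P.rep 0 = 0 ∧ hermPt q P.rep ∧ quadPt a b c d e f P.rep} ∈
      ({1, q ^ 2 + 1, 2 * q ^ 2 + 1} : Set ℕ) := by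
  obtain ⟨p, n, -, hp, -, rfl⟩ := hq
  set q := p ^ n with hqdef
  have hqodd : Odd q := hp.pow
  have hq0 : q ≠ 0 := hqodd.pos.ne'
  have h2 : (2 : F) ≠ 0 := by
    refine Ring.two_ne_zero fun hc => ?_
    have h := FiniteField.even_card_of_char_two hc
    rw [hF, Nat.odd_iff.1 hqodd.pow] at h
    exact one_ne_zero h
  have hneg : IsSquare (-1 : F) := by
    rw [FiniteField.isSquare_neg_one_iff, hF, Nat.pow_mod]
    have : q % 4 < 4 := Nat.mod_lt _ (by norm_num)
    interval_cases q % 4 <;> norm_num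
  obtain ⟨s, hs⟩ := hneg.mul hΔsq
  have hs' : c ^ 2 - 4 * a * b = s * s := by rw [← hs]; ring
  have hs0 : s ≠ 0 := by
    rintro rfl
    apply hΔne
    linear_combination -hs
  obtain ⟨α, β, γ, δ, hdet, hfac⟩ := exists_linear_factors h2 a b c s hs' hs0
  let R : F → F → Prop := fun x y =>
    x ^ (q + 1) + y ^ (q + 1) = 0 ∧ a * x ^ 2 + b * y ^ 2 + c * x * y = 0
  have hcard := card_cone_at_infinity R (by simp [R])
    (fun t x y ht => by
      have h1 : (t * x) ^ (q + 1) + (t * y) ^ (q + 1) =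
        t ^ (q + 1) * (x ^ (q + 1) + y ^ (q + 1)) := by ring
      have h2 : a * (t * x) ^ 2 + b * (t * y) ^ 2 + c * (t * x) * (t * y) =
        t ^ 2 * (a * x ^ 2 + b * y ^ 2 + c * x * y) := by ring
      simp only [R, h1, h2, mul_eq_zero, pow_ne_zero _ ht, false_or])
    (fun i => bif i then -β else -δ) (fun i => bif i then α else γ)
    (by
      simp only [cond_true, cond_false]
      intro h
      apply hdet
      linear_combination h)
    (by
      rintro x y ⟨-, h⟩
      rw [hfac, mul_eq_zero] at h
      rcases h with h | h
      · refine ⟨true, (γ * x + δ * y) / (α * δ - β * γ), ?_, ?_⟩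
        · simp only [cond_true]
          rw [div_mul_eq_mul_div, eq_div_iff hdet]
          linear_combination δ * h
        · simp only [cond_true]
          rw [div_mul_eq_mul_div, eq_div_iff hdet]
          linear_combination -γ * h
      · refine ⟨false, -(α * x + β * y) / (α * δ - β * γ), ?_, ?_⟩
        · simp only [cond_false]
          rw [div_mul_eq_mul_div, eq_div_iff hdet]
          linear_combination -β * h
        · simp only [cond_false]
          rw [div_mul_eq_mul_div, eq_div_iff hdet]
          linear_combination α * h)
  have hiff : ∀ P : Projectivization F (Fin 4 → F),
      (P.rep 0 = 0 ∧ hermPt q P.rep ∧ quadPt a b c d e f P.rep) ↔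
        (P.rep 0 = 0 ∧ R (P.rep 1) (P.rep 2)) := by
    intro P
    refine and_congr_right fun h0 => ?_
    simp [hermPt, quadPt, R, h0, hq0, eq_comm]
  rw [Nat.card_congr (Equiv.subtypeEquivRight hiff), hcard, hF]
  generalize hk : Nat.card {i : Bool // R _ _} = k
  have hk2 : k ≤ 2 := by
    rw [← hk]
    simpa using Finite.card_subtype_le (α := Bool) _
  interval_cases k <;> simp
end

section
/- Suppose a ≠ 0. Then the number of points of C∞ = H ∩ Q ∩ {j = 0} equals 1 + q²·N, where N is the number of elements x ∈ F satisfying both a·x² + c·x + b = 0 and x^(q+1) = −1. (Each such root x corresponds to a full line through P = [0:0:0:1] contained in C∞.) -/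
theorem hermPt_iff_of_apply_zero {q : ℕ} (hq : q ≠ 0) {F : Type} [Field F] {v : Fin 4 → F}
    (h : v 0 = 0) : hermPt q v ↔ v 1 ^ (q + 1) + v 2 ^ (q + 1) = 0 := by
  simp [hermPt, h, hq, eq_comm]

theorem quadPt_iff_of_apply_zero {F : Type} [Field F] {a b c d e f : F} {v : Fin 4 → F}
    (h : v 0 = 0) :
    quadPt a b c d e f v ↔ a * v 1 ^ 2 + b * v 2 ^ 2 + c * v 1 * v 2 = 0 := by
  simp [quadPt, h, eq_comm]

/-- The vertex `[0:0:0:1]` together with the affine points `[0:x:1:z]` of the plane `j = 0`. -/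
def planePoint {F : Type} [Field F] (S : Set F) :
    Option (S × F) → Projectivization F (Fin 4 → F)
  | none => .mk F ![0, 0, 0, 1] fun h => one_ne_zero (congrFun h 3)
  | some (x, z) => .mk F ![0, x, 1, z] fun h => one_ne_zero (congrFun h 2)

theorem planePoint_injective {F : Type} [Field F] (S : Set F) :
    Function.Injective (planePoint S) := by
  rintro (_ | ⟨x, z⟩) (_ | ⟨y, w⟩) h
  · rfl
  · obtain ⟨k, hk⟩ := (Projectivization.mk_eq_mk_iff' F _ _ _ _).1 h
    have h2 := congrFun hk 2
    have h3 := congrFun hk 3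
    simp at h2 h3
    simp [h2] at h3
  · obtain ⟨k, hk⟩ := (Projectivization.mk_eq_mk_iff' F _ _ _ _).1 h
    simpa using congrFun hk 2
  · obtain ⟨k, hk⟩ := (Projectivization.mk_eq_mk_iff' F _ _ _ _).1 h
    have h1 := congrFun hk 1
    have h2 := congrFun hk 2
    have h3 := congrFun hk 3
    simp at h1 h2 h3
    subst h2
    have hxy : x = y := Subtype.ext (by simpa using h1.symm)
    have hzw : z = w := by simpa using h3.symm
    rw [hxy, hzw]

theorem range_planePoint {q : ℕ} (hq : q ≠ 0) {F : Type} [Field F]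
    (a b c d e f : F) (ha : a ≠ 0) :
    Set.range (planePoint {x : F | a * x ^ 2 + c * x + b = 0 ∧ x ^ (q + 1) = -1}) =
      {P | P.rep 0 = 0 ∧ hermPt q P.rep ∧ quadPt a b c d e f P.rep} := by
  ext P
  constructor
  · rintro ⟨_ | ⟨⟨x, hx, hx'⟩, z⟩, rfl⟩
    · obtain ⟨k, hk⟩ := Projectivization.exists_smul_eq_mk_rep F ![(0 : F), 0, 0, 1]
        fun h => one_ne_zero (congrFun h 3)
      simp only [planePoint, Set.mem_ofPred_eq, ← hk]
      have h0 : (k • ![(0 : F), 0, 0, 1]) 0 = 0 := by simp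
      rw [hermPt_iff_of_apply_zero hq h0, quadPt_iff_of_apply_zero h0]
      simp
    · obtain ⟨k, hk⟩ := Projectivization.exists_smul_eq_mk_rep F ![(0 : F), x, 1, z]
        fun h => one_ne_zero (congrFun h 2)
      simp only [planePoint, Set.mem_ofPred_eq, ← hk]
      have h0 : (k • ![(0 : F), x, 1, z]) 0 = 0 := by simp
      rw [hermPt_iff_of_apply_zero hq h0, quadPt_iff_of_apply_zero h0]
      refine ⟨h0, ?_, ?_⟩
      · simp [Units.smul_def, mul_pow, hx']
      · simp only [Units.smul_def, Pi.smul_apply, smul_eq_mul, Matrix.cons_val]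
        linear_combination (k : F) ^ 2 * hx
  · rintro ⟨h0, hH, hQ⟩
    rw [hermPt_iff_of_apply_zero hq h0] at hH
    rw [quadPt_iff_of_apply_zero h0] at hQ
    by_cases h2 : P.rep 2 = 0
    · have h1 : P.rep 1 = 0 := by simpa [h2, ha] using hQ
      refine ⟨none, ?_⟩
      rw [← P.mk_rep]
      refine (Projectivization.mk_eq_mk_iff' F _ _ _ _).2 ⟨(P.rep 3)⁻¹, ?_⟩
      have h3 : P.rep 3 ≠ 0 := fun h3 => P.rep_nonzero <| by
        ext i; fin_cases i <;> assumption
      ext i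
      fin_cases i <;> simp [h0, h1, h2, h3]
    · refine ⟨some (⟨P.rep 1 / P.rep 2, ?_, ?_⟩, P.rep 3 / P.rep 2), ?_⟩
      · field_simp
        linear_combination hQ
      · rw [div_pow, div_eq_iff (pow_ne_zero _ h2)]
        linear_combination hH
      · conv_rhs => rw [← P.mk_rep]
        refine (Projectivization.mk_eq_mk_iff' F _ _ _ _).2 ⟨(P.rep 2)⁻¹, ?_⟩
        ext i
        fin_cases i <;> simp [h0, h2, div_eq_inv_mul]

theorem card_points_at_infinity_of_a_ne_zero
    (q : ℕ) (hq : ∃ p n : ℕ, p.Prime ∧ Odd p ∧ 0 < n ∧ q = p ^ n)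
    (F : Type) [Field F] [Fintype F] (hF : Fintype.card F = q ^ 2)
    (a b c d e f : F) (ha : a ≠ 0) :
    Nat.card {P : Projectivization F (Fin 4 → F) //
        P.rep 0 = 0 ∧ hermPt q P.rep ∧ quadPt a b c d e f P.rep} =
      1 + q ^ 2 *
        Nat.card {x : F // a * x ^ 2 + c * x + b = 0 ∧ x ^ (q + 1) = -1} := by
  have hq0 : q ≠ 0 := by
    obtain ⟨p, n, hp, -, -, rfl⟩ := hq
    exact pow_ne_zero n hp.ne_zero
  have h := Nat.card_range_of_injective
    (planePoint_injective {x : F | a * x ^ 2 + c * x + b = 0 ∧ x ^ (q + 1) = -1})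
  rw [range_planePoint hq0 a b c d e f ha, Finite.card_option, Nat.card_prod,
    Nat.card_eq_fintype_card (α := F), hF] at h
  exact h.trans (by rw [add_comm, mul_comm]; rfl)
end
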